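/- arXiv:2011.11054 — 5 statements merged into one kernel-verified Lean document; each statement's English description precedes it below -/
import Mathlib

section
/- Let p be an odd prime and let η_p = 1 if p ≡ 1 (mod 4) and η_p = i if p ≡ 3 (mod 4). Then for every integer s, the quadratic character modulo p is a fixed point of the finite Fourier transform: Σ_{t=0}^{p−1} (t|p)·e^{2πi s t/p} = η_p·√p·(s|p), where (0|p) is interpreted as 0. -/
open Polynomial

/-- power sums -/
theorem aux_A (p : ℕ) [Fact p.Prime] (k : ℕ) (hk : k ≤ p - 1) :
    ∃ P : (ZMod p)[X], (∑ j ∈ Finset.range p, C ((j : ZMod p) ^ k) * X ^ j) = (X - 1) ^ (p - 1 - k) * P ∧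
      P.eval 1 = (-1) ^ k * (k.factorial : ZMod p) := by
  have hp := (Fact.out : p.Prime)
  induction k with
  | zero =>
    refine ⟨1, ?_, by simp⟩
    have h1 : (X - 1 : (ZMod p)[X]) ≠ 0 := by simpa using X_sub_C_ne_zero (1 : ZMod p)
    apply mul_right_cancel₀ h1
    simp only [pow_zero, map_one, one_mul, mul_one, Nat.sub_zero]
    rw [geom_sum_mul, ← pow_succ, Nat.sub_add_cancel hp.one_le, sub_pow_char, one_pow]
  | succ k ih =>
    obtain ⟨P, hP, hP1⟩ := ih (by omega)
    obtain ⟨n, hn⟩ : ∃ n, p - 1 - k = n + 1 := ⟨p - 1 - k - 1, by omega⟩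
    have hn' : p - 1 - (k + 1) = n := by omega
    refine ⟨X * (((n + 1 : ℕ) : (ZMod p)[X]) * P + (X - 1) * derivative P), ?_, ?_⟩
    · have := congrArg (fun q => X * derivative q) hP
      rw [hn] at this
      rw [hn']
      have e : X * derivative (∑ j ∈ Finset.range p, C ((j : ZMod p) ^ k) * X ^ j) =
        ∑ j ∈ Finset.range p, C ((j : ZMod p) ^ (k+1)) * X ^ j := by
        rw [derivative_sum, Finset.mul_sum]
        refine Finset.sum_congr rfl fun j _ => ?_
        rw [derivative_C_mul_X_pow]
        rcases j with _ | j
        · simp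
        · simp only [Nat.add_sub_cancel, pow_succ, map_mul]; ring
      rw [← e, this, derivative_mul, derivative_pow]
      simp
      ring
    · have : ((n + 1 : ℕ) : ZMod p) = - ((k + 1 : ℕ) : ZMod p) := by
        rw [eq_neg_iff_add_eq_zero, ← Nat.cast_add, show n + 1 + (k + 1) = p by omega]; simp
      simp only [eval_mul, eval_add, eval_X, eval_natCast, this, hP1, Nat.factorial_succ]
      simp; ring

theorem aux_B (p : ℕ) [Fact p.Prime] (m c : ℕ) (hc : 2 * c = p + 1) (hm : p = 2 * m + 1) :
    ∃ Q : (ZMod p)[X], (∏ j ∈ Finset.range m, ((X : (ZMod p)[X]) ^ (c * (p - (j+1))) - X ^ (c * (j+1)))) = (X - 1) ^ m * Q ∧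
      Q.eval 1 = (-1) ^ m * (m.factorial : ZMod p) := by
  have h (a : ℕ) : ∃ q : (ZMod p)[X], X ^ a - 1 = (X - 1) * q ∧ q.eval 1 = a :=
    ⟨∑ i ∈ Finset.range a, X ^ i, by rw [mul_geom_sum], by simp [eval_finsetSum]⟩
  choose q hq hq1 using h
  refine ⟨∏ j ∈ Finset.range m, (q (c * (p - (j+1))) - q (c * (j+1))), ?_, ?_⟩
  · rw [← Finset.card_range m, ← Finset.prod_const, Finset.card_range, ← Finset.prod_mul_distrib]
    refine Finset.prod_congr rfl fun j _ => ?_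
    rw [mul_sub, ← hq, ← hq]; ring
  · rw [eval_prod, ← Finset.prod_range_add_one_eq_factorial]
    conv_rhs => rw [← Finset.card_range m, ← Finset.prod_const, Finset.card_range, Nat.cast_prod]
    rw [← Finset.prod_mul_distrib]
    refine Finset.prod_congr rfl fun j hj => ?_
    have hj := Finset.mem_range.1 hj
    rw [eval_sub, hq1, hq1]
    have hc' : (2 * c : ZMod p) = 1 := by
      have := congrArg (Nat.cast : ℕ → ZMod p) hc
      simpa using this
    rw [Nat.cast_mul, Nat.cast_sub (by omega)]
    push_cast
    simp only [CharP.cast_eq_zero]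
    linear_combination (-(j:ZMod p) - 1) * hc'

theorem aux_eps (p : ℕ) [Fact p.Prime] (m c : ℕ) (hc : 2 * c = p + 1) (hm : p = 2 * m + 1) (ζ : ℂ)
    (hζ : IsPrimitiveRoot ζ p)
    (h : ∑ j ∈ Finset.range p, (legendreSym p j : ℂ) * ζ ^ j =
      - ∏ j ∈ Finset.range m, (ζ ^ (c * (p - (j+1))) - ζ ^ (c * (j+1)))) : False := by
  have hp := (Fact.out : p.Prime)
  have hm0 : 0 < m := by have := hp.two_le; omega
  set f : ℤ[X] := ∑ j ∈ Finset.range p, C (legendreSym p j) * X ^ j +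
    ∏ j ∈ Finset.range m, (X ^ (c * (p - (j+1))) - X ^ (c * (j+1))) with hf
  have h0 : aeval ζ f = 0 := by
    simp [hf, h]
  have hd : cyclotomic p ℤ ∣ f := by
    rw [cyclotomic_eq_minpoly hζ hp.pos]
    exact minpoly.isIntegrallyClosed_dvd (hζ.isIntegral hp.pos) h0
  have hd2 := Polynomial.map_dvd (Int.castRingHom (ZMod p)) hd
  obtain ⟨P, hP, hP1⟩ := aux_A p m (by omega)
  obtain ⟨Q, hQ, hQ1⟩ := aux_B p m c hc hm
  obtain ⟨P0, hP0, hP01⟩ := aux_A p 0 (by omega)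
  have hcyc : map (Int.castRingHom (ZMod p)) (cyclotomic p ℤ) = (X - 1) ^ (p - 1) := by
    have h1 : (X - 1 : (ZMod p)[X]) ≠ 0 := by simpa using X_sub_C_ne_zero (1 : ZMod p)
    apply mul_right_cancel₀ h1
    rw [map_cyclotomic, cyclotomic_prime, geom_sum_mul, ← pow_succ, Nat.sub_add_cancel hp.one_le, sub_pow_char, one_pow]
  have hfm : map (Int.castRingHom (ZMod p)) f = (X - 1) ^ m * (P + Q) := by
    rw [mul_add, ← hQ]
    rw [show p - 1 - m = m by omega] at hP
    rw [← hP, hf]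
    simp only [Polynomial.map_add, Polynomial.map_sum, Polynomial.map_prod, Polynomial.map_mul, Polynomial.map_sub, Polynomial.map_pow, map_X, map_C]
    congr 1
    refine Finset.sum_congr rfl fun j _ => ?_
    congr 2
    have := legendreSym.eq_pow p j
    rw [show p / 2 = m by omega] at this
    simpa using this
  rw [hcyc, hfm, show p - 1 = m + m by omega, pow_add] at hd2
  have hd3 := (mul_dvd_mul_iff_left (pow_ne_zero m (by simpa using X_sub_C_ne_zero (1 : ZMod p)))).1 hd2
  have hd4 : (X - 1 : (ZMod p)[X]) ∣ P + Q := (dvd_pow_self _ hm0.ne').trans hd3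
  have he : (P + Q).eval 1 = 0 := by
    obtain ⟨r, hr⟩ := hd4
    rw [hr]; simp
  rw [eval_add, hP1, hQ1, ← two_mul] at he
  have h2 : (2 : ZMod p) ≠ 0 := by
    intro h2
    have : ((2:ℕ) : ZMod p) = 0 := by exact_mod_cast h2
    rw [ZMod.natCast_eq_zero_iff] at this
    have := Nat.le_of_dvd (by norm_num) this
    omega
  have h3 : (m.factorial : ZMod p) ≠ 0 := by
    rw [Ne, ZMod.natCast_eq_zero_iff, hp.dvd_factorial]; omega
  simp [h2, h3] at he

theorem aux_sign (m : ℕ) : ∏ j ∈ Finset.range m, ((-1 : ℂ) ^ j * Complex.I) = if m % 2 = 0 then 1 else Complex.I := by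
  induction m with
  | zero => simp
  | succ k ih =>
    rw [Finset.prod_range_succ, ih]
    rcases Nat.even_or_odd k with h | h
    · rw [h.neg_one_pow, if_pos (Nat.even_iff.1 h), if_neg (by have := Nat.even_iff.1 h; omega)]; simp
    · rw [h.neg_one_pow, if_neg (by have := Nat.odd_iff.1 h; omega), if_pos (by have := Nat.odd_iff.1 h; omega)]; simp

theorem aux_prod (p : ℕ) [Fact p.Prime] (m : ℕ) (hm : p = 2 * m + 1) (ζ : ℂ)
    (hζ : ζ = Complex.exp (2 * Real.pi * Complex.I / p)) :
    ∏ j ∈ Finset.range m, (ζ ^ ((m + 1) * (p - (j+1))) - ζ ^ ((m + 1) * (j+1))) =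
      (if p % 4 = 1 then 1 else Complex.I) * Real.sqrt p := by
  have hp := (Fact.out : p.Prime)
  have hp0 : (p : ℂ) ≠ 0 := by exact_mod_cast hp.ne_zero
  have hprim : IsPrimitiveRoot ζ p := hζ ▸ Complex.isPrimitiveRoot_exp p hp.ne_zero
  set v : ℂ := Complex.exp (Real.pi * Complex.I / p) with hv
  have hv2 : ζ = v ^ 2 := by
    rw [hζ, hv, ← Complex.exp_nat_mul]; congr 1; push_cast; ring
  have hvp : v ^ p = -1 := by
    rw [hv, ← Complex.exp_nat_mul, mul_div_cancel₀ _ hp0, Complex.exp_pi_mul_I]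
  have hv0 : v ≠ 0 := Complex.exp_ne_zero _
  have hw : ζ ^ (m + 1) = - v := by
    rw [hv2, ← pow_mul, show 2 * (m + 1) = p + 1 by omega, pow_succ, hvp]; ring
  have hsin (j : ℕ) : (2 * Complex.I * (Real.sin (Real.pi * j / p) : ℂ)) = v ^ j - (v ^ j)⁻¹ := by
    rw [hv, ← Complex.exp_nat_mul, ← Complex.exp_neg, Complex.ofReal_sin, Complex.sin]
    push_cast
    rw [show -(Real.pi * j / p : ℂ) * Complex.I = -(j * (Real.pi * Complex.I / p)) by ring,
      show (Real.pi * j / p : ℂ) * Complex.I = (j * (Real.pi * Complex.I / p)) by ring]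
    linear_combination (Complex.exp (-(j * (Real.pi * Complex.I / p))) - Complex.exp (j * (Real.pi * Complex.I / p))) * Complex.I_mul_I
  have hpw (j : ℕ) (hj : j ≤ p) : v ^ (p - j) = - (v ^ j)⁻¹ := by
    rw [pow_sub₀ _ hv0 hj, hvp]; ring
  set r : ℝ := ∏ j ∈ Finset.range m, (2 * Real.sin (Real.pi * (j + 1 : ℕ) / p)) with hr
  have hrpos : 0 < r := by
    refine Finset.prod_pos fun j hj => ?_
    have hj := Finset.mem_range.1 hj
    have hpp : (0 : ℝ) < p := by exact_mod_cast hp.pos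
    refine mul_pos two_pos (Real.sin_pos_of_pos_of_lt_pi (by positivity) ?_)
    rw [div_lt_iff₀ hpp]
    have : ((j + 1 : ℕ) : ℝ) < p := by exact_mod_cast (by omega)
    exact mul_lt_mul_of_pos_left this Real.pi_pos
  have hodd : Odd p := ⟨m, hm⟩
  have hr2 : (r : ℂ) ^ 2 = p := by
    have h1 : ∏ i ∈ Finset.range (m + m), (1 - ζ ^ (i + 1)) = p := by
      have : p = (m + m) + 1 := by omega
      have hpr := hprim
      rw [this] at hpr
      rw [hpr.prod_one_sub_pow_eq_order, this]; push_cast; ring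
    rw [← h1, Finset.prod_range_add, ← Finset.prod_range_reflect (fun x => 1 - ζ ^ (m + x + 1)), ← Finset.prod_mul_distrib,
      hr, Complex.ofReal_prod, ← Finset.prod_pow]
    refine Finset.prod_congr rfl fun j hj => ?_
    have hj := Finset.mem_range.1 hj
    have e : m + (m - 1 - j) + 1 = p - (j + 1) := by omega
    have hs := hsin (j + 1)
    have hne : v ^ (j + 1) ≠ 0 := pow_ne_zero _ hv0
    have h3 : ζ ^ (p - (j+1)) = (v ^ (j + 1))⁻¹ ^ 2 := by
      rw [hv2, ← pow_mul, mul_comm, pow_mul, hpw _ (by omega)]; ring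
    have h4 : ζ ^ (j+1) = (v ^ (j + 1)) ^ 2 := by
      rw [hv2, ← pow_mul, mul_comm, pow_mul]
    rw [e, h3, h4]
    have h5 : ((2 * Real.sin (Real.pi * (j + 1 : ℕ) / p) : ℝ) : ℂ) ^ 2 = - (v ^ (j + 1) - (v ^ (j + 1))⁻¹) ^ 2 := by
      rw [← hs, mul_pow, mul_pow, Complex.I_sq, Complex.ofReal_mul]; push_cast; ring
    rw [h5]
    field_simp
    ring
  have hrs : r = Real.sqrt p := by
    have : r ^ 2 = p := by exact_mod_cast hr2
    rw [← this, Real.sqrt_sq hrpos.le]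
  have hcond : (p % 4 = 1) ↔ m % 2 = 0 := by omega
  simp only [hcond]
  rw [← hrs, ← aux_sign, hr, Complex.ofReal_prod, ← Finset.prod_mul_distrib]
  refine Finset.prod_congr rfl fun j hj => ?_
  have hj := Finset.mem_range.1 hj
  have hs := hsin (j + 1)
  rw [pow_mul, pow_mul, hw, Complex.ofReal_mul]
  have h6 : (-1 : ℂ) ^ j * Complex.I * (((2 : ℝ) : ℂ) * (Real.sin (Real.pi * (j + 1 : ℕ) / p) : ℂ)) =
     (-1) ^ j * (v ^ (j+1) - (v ^ (j+1))⁻¹) := by rw [← hs]; push_cast; ring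
  rw [h6, neg_pow v (j+1), neg_pow v (p - (j+1)), hpw _ (by omega)]
  have h7 : (-1 : ℂ) ^ (p - (j + 1)) = (-1) ^ j := by
    rw [show p - (j + 1) = 2 * (m - j) + j by omega, pow_add, pow_mul]; simp
  rw [h7, pow_succ (-1 : ℂ)]; ring

theorem aux_std (p : ℕ) [Fact p.Prime] (s : ℤ) (t : ℕ) :
    ZMod.stdAddChar ((s : ZMod p) * (t : ZMod p)) = Complex.exp (2 * Real.pi * Complex.I * s * t / p) := by
  have := ZMod.stdAddChar_coe (N := p) (s * t)
  push_cast at this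
  rw [this]; congr 1; ring

/-- sum over range as Gauss sum -/
theorem aux_gauss (p : ℕ) [Fact p.Prime] (s : ℤ) :
    ∑ t ∈ Finset.range p, (legendreSym p t : ℂ) * Complex.exp (2 * Real.pi * Complex.I * s * t / p) =
    gaussSum ((quadraticChar (ZMod p)).ringHomComp (Int.castRingHom ℂ)) (AddChar.mulShift ZMod.stdAddChar (s : ZMod p)) := by
  rw [gaussSum]
  refine Finset.sum_bij' (fun t _ => (t : ZMod p)) (fun x _ => x.val) ?_ ?_ ?_ ?_ ?_
  · simp
  · intro x _; exact Finset.mem_range.2 (ZMod.val_lt x)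
  · intro t ht; exact ZMod.val_cast_of_lt (Finset.mem_range.1 ht)
  · intro x _; exact ZMod.natCast_zmod_val x
  · intro t ht
    rw [AddChar.mulShift_apply, aux_std]
    simp [legendreSym]

theorem aux_one (p : ℕ) [Fact p.Prime] (hp : Odd p) :
    gaussSum ((quadraticChar (ZMod p)).ringHomComp (Int.castRingHom ℂ)) ZMod.stdAddChar =
      (if p % 4 = 1 then 1 else Complex.I) * Real.sqrt p := by
  obtain ⟨m, hm⟩ := hp
  have hpp := (Fact.out : p.Prime)
  have hchar : ringChar (ZMod p) ≠ 2 := by rw [ZMod.ringChar_zmod_n]; omega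
  set χ := (quadraticChar (ZMod p)).ringHomComp (Int.castRingHom ℂ) with hχ
  have hsq : gaussSum χ ZMod.stdAddChar ^ 2 = ((if p % 4 = 1 then 1 else Complex.I) * Real.sqrt p) ^ 2 := by
    rw [gaussSum_sq ((MulChar.ringHomComp_ne_one_iff (RingHom.injective_int _)).2 (quadraticChar_ne_one hchar))
      ((quadraticChar_isQuadratic _).comp _) (ZMod.isPrimitive_stdAddChar p), ZMod.card, mul_pow]
    congr 1
    · rw [MulChar.ringHomComp_apply, quadraticChar_neg_one hchar, ZMod.card]
      split_ifs with h
      · rw [ZMod.χ₄_nat_one_mod_four h]; simp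
      · rw [ZMod.χ₄_nat_three_mod_four (by omega)]; simp
    · rw [← Complex.ofReal_pow, Real.sq_sqrt (Nat.cast_nonneg _)]; simp
  rcases sq_eq_sq_iff_eq_or_eq_neg.1 hsq with h | h
  · exact h
  · exfalso
    have hg := aux_gauss p 1
    rw [Int.cast_one, Int.cast_one, AddChar.mulShift_one, ← hχ, h] at hg
    refine aux_eps p m (m + 1) (by omega) hm _ (Complex.isPrimitiveRoot_exp p hpp.ne_zero) ?_
    rw [aux_prod p m hm _ rfl, ← hg]
    refine Finset.sum_congr rfl fun t _ => ?_
    rw [← Complex.exp_nat_mul]; congr 2; push_cast; ring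

open Complex

/-- For an odd prime `p`, with `η_p = 1` if `p ≡ 1 (mod 4)` and `η_p = i`
if `p ≡ 3 (mod 4)`, and any integer `s`:
`Σ_{t=0}^{p−1} (t|p)·e^{2πi s t/p} = η_p·√p·(s|p)`. -/
theorem quadratic_character_fourier_fixed_point
    (p : ℕ) [Fact p.Prime] (hp : Odd p) (s : ℤ) :
    ∑ t ∈ Finset.range p, (legendreSym p t : ℂ) *
        Complex.exp (2 * Real.pi * Complex.I * s * t / p) =
      (if p % 4 = 1 then 1 else Complex.I) * Real.sqrt p * (legendreSym p s : ℂ) := by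
  have hchar : ringChar (ZMod p) ≠ 2 := by
    rw [ZMod.ringChar_zmod_n]; rintro rfl; exact absurd hp (by decide)
  rw [aux_gauss, ← aux_one p hp]
  by_cases hs : (s : ZMod p) = 0
  · rw [hs, AddChar.mulShift_zero, gaussSum_one_right
      ((MulChar.ringHomComp_ne_one_iff (RingHom.injective_int _)).2 (quadraticChar_ne_one hchar)),
      (legendreSym.eq_zero_iff p s).2 hs]
    simp
  · have h := gaussSum_mulShift_eq ((quadraticChar (ZMod p)).ringHomComp (Int.castRingHom ℂ))
      ZMod.stdAddChar (Units.mk0 (s : ZMod p) hs)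
    rw [((quadraticChar_isQuadratic (ZMod p)).comp _).inv, Units.val_mk0] at h
    rw [h, mul_comm]
    rfl
end

section
/- Let p be an odd prime. Then the quadratic Gauss sum satisfies Σ_{u=0}^{p−1} e^{2πi u²/p} = √p if p ≡ 1 (mod 4), and Σ_{u=0}^{p−1} e^{2πi u²/p} = i·√p if p ≡ 3 (mod 4). -/
open Complex Filter Topology in
lemma theta_tendsto_one (x : ℝ) {g : ℝ → ℂ} (hg : ∀ T, (g T).im = T) :
    Tendsto (fun T : ℝ => jacobiTheta₂ x (g T)) atTop (𝓝 1) := by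
  have h1 : Summable (fun n : ℤ => ‖jacobiTheta₂_term n 0 I‖) :=
    ((summable_jacobiTheta₂_term_iff 0 I).mpr (by simp)).norm
  have h := tendsto_tsum_of_dominated_convergence (𝓕 := (atTop : Filter ℝ))
    (f := fun T n => jacobiTheta₂_term n x (g T)) (g := fun n : ℤ => if n = 0 then (1 : ℂ) else 0)
    h1 ?_ ?_
  · simpa [jacobiTheta₂] using h
  · intro n
    by_cases hn : n = 0
    · subst hn
      simp [jacobiTheta₂_term]
    · simp only [hn, if_false]
      rw [tendsto_zero_iff_norm_tendsto_zero]
      simp only [norm_jacobiTheta₂_term, hg, ofReal_im, mul_zero, sub_zero]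
      refine Real.tendsto_exp_atBot.comp ?_
      have : 0 < Real.pi * (n : ℝ) ^ 2 := by positivity
      have h2 := (tendsto_id (α := ℝ) (x := atTop)).const_mul_atTop_of_neg (r := -Real.pi * (n : ℝ) ^ 2)
        (by linarith)
      exact h2
  · filter_upwards [eventually_ge_atTop 1] with T hT n
    simp only [norm_jacobiTheta₂_term, hg, ofReal_im, mul_zero, sub_zero, I_im, zero_im]
    apply Real.exp_le_exp.mpr
    have : 0 ≤ Real.pi * (n : ℝ) ^ 2 := by positivity
    nlinarith

open Complex in
lemma theta_split (N : ℕ) [NeZero N] (α s : ℂ) (hα : α.im = 0) (hs : 0 < s.im)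
    (hper : ∀ k r : ℤ, ∃ m : ℤ, ((k : ℂ) * N + r) ^ 2 * α = r ^ 2 * α + 2 * m) :
    jacobiTheta₂ 0 (α + s) = 1 / (-I * (N ^ 2 * s)) ^ (1 / 2 : ℂ) *
      ∑ r ∈ Finset.range N, cexp (Real.pi * I * r ^ 2 * α) *
        jacobiTheta₂ ((r / N : ℝ) : ℂ) (-1 / (N ^ 2 * s)) := by
  have hN : (N : ℂ) ≠ 0 := by exact_mod_cast NeZero.ne N
  have hs0 : s ≠ 0 := by rintro rfl; simp at hs
  have hsum : Summable (fun n : ℤ => jacobiTheta₂_term n 0 (α + s)) :=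
    (summable_jacobiTheta₂_term_iff 0 _).mpr (by simp [hα, hs])
  have hsum2 := ((Int.divModEquiv N).trans (Equiv.prodComm _ _)).symm.summable_iff.mpr hsum
  rw [jacobiTheta₂, ← ((Int.divModEquiv N).trans (Equiv.prodComm _ _)).symm.tsum_eq]
  erw [Summable.tsum_prod hsum2]
  rw [tsum_fintype, ← Fin.sum_univ_eq_sum_range (fun r => cexp (Real.pi * I * r ^ 2 * α) *
        jacobiTheta₂ ((r / N : ℝ) : ℂ) (-1 / (N ^ 2 * s))), Finset.mul_sum]
  refine Finset.sum_congr rfl fun r _ => ?_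
  have key : ∀ k : ℤ, jacobiTheta₂_term ((k : ℤ) * N + ((r : ℕ) : ℤ)) 0 (α + s) =
      cexp (Real.pi * I * (r : ℕ) ^ 2 * α) * cexp (Real.pi * I * (r : ℕ) ^ 2 * s) *
        jacobiTheta₂_term k ((N : ℂ) * (r : ℕ) * s) (N ^ 2 * s) := by
    intro k
    obtain ⟨m, hm⟩ := hper k (r : ℕ)
    simp only [jacobiTheta₂_term]
    rw [← Complex.exp_add, ← Complex.exp_add, Complex.exp_eq_exp_iff_exists_int]
    refine ⟨m, ?_⟩
    push_cast at hm ⊢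
    linear_combination (Real.pi * I : ℂ) * hm
  have h3 : ∀ k : ℤ, ((fun n : ℤ => jacobiTheta₂_term n 0 (α + s)) ∘
      ((Int.divModEquiv N).trans (Equiv.prodComm _ _)).symm) (r, k) = 
      jacobiTheta₂_term ((k : ℤ) * N + ((r : ℕ) : ℤ)) 0 (α + s) := by
    intro k
    rfl
  rw [tsum_congr (fun k => (h3 k).trans (key k)), tsum_mul_left]
  change _ * jacobiTheta₂ _ _ = _
  rw [jacobiTheta₂_functional_equation]
  have e1 : (N : ℂ) * (r : ℕ) * s / (N ^ 2 * s) = (((r : ℕ) / N : ℝ) : ℂ) := by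
    push_cast; field_simp
  have e2 : cexp (-Real.pi * I * ((N : ℂ) * (r : ℕ) * s) ^ 2 / (N ^ 2 * s)) =
      (cexp (Real.pi * I * (r : ℕ) ^ 2 * s))⁻¹ := by
    rw [← Complex.exp_neg]; congr 1; field_simp
  rw [e1, e2]
  field_simp [Complex.exp_ne_zero]

open Complex in
lemma ofReal_mul_cpow_half {t : ℝ} (ht : 0 < t) (z : ℂ) (hz : z ≠ 0) (r : ℂ) :
    ((t : ℂ) * z) ^ r = (t : ℂ) ^ r * z ^ r := by
  have ht' : (t : ℂ) ≠ 0 := by exact_mod_cast ht.ne'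
  rw [cpow_def_of_ne_zero (mul_ne_zero ht' hz), cpow_def_of_ne_zero ht', cpow_def_of_ne_zero hz,
    log_ofReal_mul ht hz, ← Complex.exp_add, ofReal_log ht.le, add_mul]

open Complex in
lemma gauss_identity (p : ℕ) (hp : 0 < p) (T : ℝ) (hT : 0 < T) :
    (1 / (1 / (1 - I / (2 * p * T))) ^ (1 / 2 : ℂ)) *
      ∑ r ∈ Finset.range p, cexp (Real.pi * I * r ^ 2 * (2 / p)) *
        jacobiTheta₂ ((r / p : ℝ) : ℂ) (I * T + ((1 / (2 * p) : ℝ) : ℂ)) =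
    1 / (I / (-p / 2 + I / (4 * T))) ^ (1 / 2 : ℂ) *
      (jacobiTheta₂ ((0 : ℝ) : ℂ) (I * T) + cexp (-Real.pi * I * p / 2) *
        jacobiTheta₂ ((1 / 2 : ℝ) : ℂ) (I * T)) := by
  have : NeZero p := ⟨hp.ne'⟩
  have hpC : (p : ℂ) ≠ 0 := by exact_mod_cast hp.ne'
  have hTC : (T : ℂ) ≠ 0 := by exact_mod_cast hT.ne'
  have hpR : (0 : ℝ) < p := by exact_mod_cast hp
  have hq0 : I * T + 1 / (2 * p) ≠ (0 : ℂ) := by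
    intro h
    have := congrArg Complex.im h
    have e : (1 / (2 * p) : ℂ) = ((1 / (2 * p) : ℝ) : ℂ) := by push_cast; rfl
    rw [e] at this
    simp only [add_im, ofReal_im, mul_im, I_re, I_im, ofReal_re] at this
    simp at this
    exact hT.ne' this
  set q : ℂ := I * T + 1 / (2 * p) with hq
  have hqim : q.im = T := by
    have e : (1 / (2 * p) : ℂ) = ((1 / (2 * p) : ℝ) : ℂ) := by push_cast; rfl
    rw [hq, e]; simp [-ofReal_div]
  have hw0 : (-p / 2 + I / (4 * T) : ℂ) ≠ 0 := by
    intro h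
    apply hq0
    have : q = (2 * I * T / p) * -(-p / 2 + I / (4 * T)) := by
      rw [hq]; field_simp; ring_nf; simp; ring
    rw [this, h]; simp
  have hx0 : (1 - I / (2 * p * T) : ℂ) ≠ 0 := by
    intro h
    apply hq0
    have : q = (I * T) * (1 - I / (2 * p * T)) := by
      rw [hq]; field_simp; ring_nf; simp; ring
    rw [this, h]; simp
  set s : ℂ := -1 / (p ^ 2 * q) with hsdef
  have hs : 0 < s.im := by
    have : s = ((1 / p ^ 2 : ℝ) : ℂ) * (-q⁻¹) := by rw [hsdef]; push_cast; field_simp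
    rw [this, im_ofReal_mul, neg_im, inv_im, hqim]
    have : 0 < normSq q := normSq_pos.mpr hq0
    rw [neg_div, neg_neg]
    positivity
  have A := theta_split p (2 / p) s (by
      have e : (2 / p : ℂ) = ((2 / p : ℝ) : ℂ) := by push_cast; rfl
      rw [e, ofReal_im]) hs (fun k r => ⟨k ^ 2 * p + 2 * k * r, by push_cast; field_simp; ring⟩)
  have B := theta_split 2 (-p / 2) (I / (4 * T)) (by
      have e : (-p / 2 : ℂ) = ((-p / 2 : ℝ) : ℂ) := by push_cast; rfl
      rw [e, ofReal_im]) (by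
      have e : (I / (4 * T) : ℂ) = ((1 / (4 * T) : ℝ) : ℂ) * I := by push_cast; field_simp
      rw [e, im_ofReal_mul, I_im]; positivity)
      (fun k r => ⟨-p * (k ^ 2 + k * r), by push_cast; field_simp; ring⟩)
  have C := jacobiTheta₂_functional_equation 0 (2 / p + s)
  have e0 : (-1 / (2 / p + s) : ℂ) = -p / 2 + I / (4 * T) := by
    have h1 : (2 / p + s : ℂ) * (-p / 2 + I / (4 * T)) = -1 := by
      have h2 : (2 / p + s : ℂ) * q = 2 * I * T / p := by
        rw [hsdef, add_mul]; 
        have : -1 / (p ^ 2 * q) * q = -1 / (p : ℂ) ^ 2 := by field_simp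
        rw [this, hq]; field_simp; ring
      have : q = (2 * I * T / p) * -(-p / 2 + I / (4 * T)) := by
        rw [hq]; field_simp; ring_nf; simp; ring
      have h3 : (2 * I * T / p : ℂ) ≠ 0 := by simp [hpC, hTC]
      rw [this] at h2
      apply mul_left_cancel₀ h3
      linear_combination -h2
    have h4 : (2 / p + s : ℂ) ≠ 0 := by
      intro h; rw [h] at h1; simp at h1
    rw [div_eq_iff h4, ← h1]; ring
  have e0' : -I * (2 / p + s) = I / (-p / 2 + I / (4 * T)) := by
    rw [← e0]
    have h4 : (2 / p + s : ℂ) ≠ 0 := by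
      intro h; rw [h] at e0; simp at e0; exact hw0 (by rw [← e0])
    field_simp
  rw [e0, e0', A] at C
  simp only [zero_div, ne_eq, OfNat.ofNat_ne_zero, not_false_eq_true, zero_pow, mul_zero,
    Complex.exp_zero, mul_one] at C
  rw [B] at C
  have e3 : (-1 / (p ^ 2 * s) : ℂ) = q := by rw [hsdef]; field_simp
  have e4 : (-I * (p ^ 2 * s) : ℂ) = ((1 / T : ℝ) : ℂ) * (1 / (1 - I / (2 * p * T))) := by
    have : q = (I * T) * (1 - I / (2 * p * T)) := by
      rw [hq]; field_simp; ring_nf; simp; ring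
    have h5 : (-I * (p ^ 2 * s) : ℂ) = I / q := by rw [hsdef]; field_simp
    rw [h5, this]; push_cast; field_simp [I_ne_zero]
  have e5 : (-1 / (((2 : ℕ) : ℂ) ^ 2 * (I / (4 * T))) : ℂ) = I * T := by
    field_simp; push_cast; ring_nf; simp
  have e6 : (-I * (((2 : ℕ) : ℂ) ^ 2 * (I / (4 * T))) : ℂ) = ((1 / T : ℝ) : ℂ) := by
    push_cast; field_simp; ring_nf; simp
  have e7 : (I * T + ((1 / (2 * p) : ℝ) : ℂ)) = q := by rw [hq]; push_cast; rfl
  rw [e3, e4, e5, e6, ofReal_mul_cpow_half (by positivity) _ (one_div_ne_zero hx0)] at C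
  rw [e7]
  have hTp : ((1 / T : ℝ) : ℂ) ^ (1 / 2 : ℂ) ≠ 0 := by
    rw [cpow_ne_zero_iff_of_exponent_ne_zero (by norm_num)]
    push_cast; simp [hTC]
  simp only [Finset.sum_range_succ, Finset.sum_range_zero] at C
  have e8 : (Real.pi * I * ((1 : ℕ) : ℂ) ^ 2 * (-p / 2)) = -Real.pi * I * p / 2 := by
    push_cast; ring
  rw [e8] at C
  have e9 : (((0 : ℕ) / (2 : ℕ) : ℝ)) = 0 := by simp
  have e10 : (((1 : ℕ) / (2 : ℕ) : ℝ)) = 1 / 2 := by simp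
  rw [e9, e10] at C
  apply mul_left_cancel₀ (one_div_ne_zero hTp)
  simp only [CharP.cast_eq_zero, ne_eq, OfNat.ofNat_ne_zero, not_false_eq_true, zero_pow, mul_zero,
    zero_mul, Complex.exp_zero, one_mul, zero_add] at C
  rw [← one_div_mul_one_div] at C
  linear_combination C

open Complex Filter Topology in
lemma gauss_limit (p : ℕ) (hp : 0 < p) :
    ∑ r ∈ Finset.range p, cexp (Real.pi * I * r ^ 2 * (2 / p)) =
      1 / (I / (-p / 2)) ^ (1 / 2 : ℂ) * (1 + cexp (-Real.pi * I * p / 2)) := by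
  have hpC : (p : ℂ) ≠ 0 := by exact_mod_cast hp.ne'
  have hpR : (0 : ℝ) < p := by exact_mod_cast hp
  have hinv : Tendsto (fun T : ℝ => ((T⁻¹ : ℝ) : ℂ)) atTop (𝓝 0) := by
    have := (continuous_ofReal.tendsto 0).comp tendsto_inv_atTop_zero
    rw [ofReal_zero] at this
    exact this
  have hx : Tendsto (fun T : ℝ => 1 / (1 / (1 - I / (2 * p * T))) ^ (1 / 2 : ℂ)) atTop (𝓝 1) := by
    have h1 : Tendsto (fun T : ℝ => 1 / (1 - I / (2 * p * T))) atTop (𝓝 (1 / (1 - I / (2 * p) * 0))) := by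
      refine Tendsto.div tendsto_const_nhds ?_ (by simp)
      refine (tendsto_const_nhds.sub (hinv.const_mul (I / (2 * p)))).congr fun T => ?_
      push_cast; rw [← div_div I (2 * p : ℂ)]; rfl
    have h2 := (h1.cpow (tendsto_const_nhds (x := (1 / 2 : ℂ))) (by simp)).inv₀ (by simp)
    simpa using h2
  have hw : Tendsto (fun T : ℝ => 1 / (I / (-p / 2 + I / (4 * T))) ^ (1 / 2 : ℂ)) atTop
      (𝓝 (1 / (I / (-p / 2)) ^ (1 / 2 : ℂ))) := by
    have h1 : Tendsto (fun T : ℝ => I / (-p / 2 + I / (4 * T))) atTop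
        (𝓝 (I / (-p / 2 + I / 4 * 0))) := by
      refine Tendsto.div tendsto_const_nhds ?_ (by simp [hpC])
      refine (tendsto_const_nhds.add (hinv.const_mul (I / 4))).congr fun T => ?_
      push_cast; rw [← div_div]; rfl
    rw [mul_zero, add_zero] at h1
    have h2 := (h1.cpow (tendsto_const_nhds (x := (1 / 2 : ℂ))) ?_).inv₀ ?_
    · simpa using h2
    · right
      have e : (I / (-p / 2) : ℂ) = ((-2 / p : ℝ) : ℂ) * I := by push_cast; field_simp
      rw [e, im_ofReal_mul, I_im]
      have : -2 / (p : ℝ) < 0 := div_neg_of_neg_of_pos (by norm_num) hpR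
      simpa using this.ne
    · rw [cpow_ne_zero_iff_of_exponent_ne_zero (by norm_num)]
      simp [hpC]
  have hL : Tendsto (fun T : ℝ => (1 / (1 / (1 - I / (2 * p * T))) ^ (1 / 2 : ℂ)) *
      ∑ r ∈ Finset.range p, cexp (Real.pi * I * r ^ 2 * (2 / p)) *
        jacobiTheta₂ ((r / p : ℝ) : ℂ) (I * T + ((1 / (2 * p) : ℝ) : ℂ))) atTop
      (𝓝 (1 * ∑ r ∈ Finset.range p, cexp (Real.pi * I * r ^ 2 * (2 / p)) * 1)) := by
    refine hx.mul (tendsto_finsetSum _ fun r _ => Tendsto.const_mul _ ?_)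
    exact theta_tendsto_one _ (fun T => by simp [-ofReal_div])
  have hR := hw.mul ((theta_tendsto_one 0 (g := fun T => I * T) (fun T => by simp)).add
    ((theta_tendsto_one (1 / 2) (g := fun T => I * T) (fun T => by simp)).const_mul
      (cexp (-Real.pi * I * p / 2))))
  have := tendsto_nhds_unique (hL.congr' (by
    filter_upwards [eventually_gt_atTop 0] with T hT
    exact gauss_identity p hp T hT)) hR
  simpa using this

open Complex in
lemma sqrt_const (p : ℕ) (hp : 0 < p) :
    (I / (-p / 2)) ^ (1 / 2 : ℂ) = (1 - I) / (Real.sqrt p : ℂ) := by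
  have hpR : (0 : ℝ) < p := by exact_mod_cast hp
  have hpC : (p : ℂ) ≠ 0 := by exact_mod_cast hp.ne'
  have hs : (0 : ℝ) < Real.sqrt p := Real.sqrt_pos.mpr hpR
  have hsC : (Real.sqrt p : ℂ) ≠ 0 := by exact_mod_cast hs.ne'
  have h2 : (Real.sqrt p : ℂ) ^ 2 = p := by
    exact_mod_cast Real.sq_sqrt hpR.le
  have e : (I / (-p / 2) : ℂ) = ((1 - I) / (Real.sqrt p : ℂ)) ^ 2 := by
    rw [div_pow, h2]; field_simp; ring_nf; simp; ring
  have e2 : (1 / 2 : ℂ) = (((2 : ℕ) : ℂ))⁻¹ := by norm_num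
  have e3 : ((1 - I) / (Real.sqrt p : ℂ)) = (((Real.sqrt p)⁻¹ : ℝ) : ℂ) * (1 - I) := by
    push_cast; field_simp
  have hre : 0 < ((1 - I) / (Real.sqrt p : ℂ)).re := by
    rw [e3, re_ofReal_mul]; simpa using hpR
  have harg := abs_lt.mp (abs_arg_lt_pi_div_two_iff.mpr (Or.inl hre))
  rw [e, e2, pow_cpow_nat_inv (by norm_num)]
  · push_cast; linarith [harg.1]
  · push_cast; linarith [harg.2]

/-- Gauss: For an odd prime `p`,
`Σ_{u=0}^{p−1} e^{2πi u²/p} = √p` if `p ≡ 1 (mod 4)`, and `= i·√p` if `p ≡ 3 (mod 4)`. -/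
theorem quadratic_gauss_sum_eval (p : ℕ) [Fact p.Prime] (hp : Odd p) :
    (p % 4 = 1 →
      ∑ u ∈ Finset.range p, Complex.exp (2 * Real.pi * Complex.I * (u : ℂ) ^ 2 / p)
        = Real.sqrt p) ∧
    (p % 4 = 3 →
      ∑ u ∈ Finset.range p, Complex.exp (2 * Real.pi * Complex.I * (u : ℂ) ^ 2 / p)
        = Complex.I * Real.sqrt p) := by
  have hp0 : 0 < p := hp.pos
  have hsC : (Real.sqrt p : ℂ) ≠ 0 := by
    exact_mod_cast (Real.sqrt_pos.mpr (by exact_mod_cast hp0)).ne'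
  have h1I : (1 - Complex.I) ≠ 0 := by
    intro h; simpa using congrArg Complex.re h
  have main : ∑ u ∈ Finset.range p, Complex.exp (2 * Real.pi * Complex.I * (u : ℂ) ^ 2 / p) =
      Real.sqrt p / (1 - Complex.I) * (1 + (-Complex.I) ^ p) := by
    have h := gauss_limit p hp0
    rw [sqrt_const p hp0, one_div_div] at h
    have e : Complex.exp (-Real.pi * Complex.I * p / 2) = (-Complex.I) ^ p := by
      rw [← Complex.exp_neg_pi_div_two_mul_I, ← Complex.exp_nat_mul]
      congr 1; ring
    rw [← e, ← h]
    refine Finset.sum_congr rfl fun u _ => ?_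
    congr 1; ring
  have h4 : (-Complex.I) ^ 4 = 1 := by rw [neg_pow, Complex.I_pow_four]; norm_num
  rw [main]
  have hmod : ∀ r, p % 4 = r → (-Complex.I) ^ p = (-Complex.I) ^ r := by
    intro r h
    conv_lhs => rw [← Nat.div_add_mod p 4, h, pow_add, pow_mul, h4, one_pow, one_mul]
  constructor
  · intro h
    rw [hmod 1 h]
    field_simp
    ring
  · intro h
    rw [hmod 3 h]
    have e : (-Complex.I) ^ 3 = Complex.I := by
      rw [neg_pow, Complex.I_pow_three]; ring
    rw [e, div_mul_eq_mul_div, div_eq_iff h1I]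
    linear_combination (Real.sqrt p : ℂ) * Complex.I_sq
end

section
/- Let p be an odd prime, let η_p = 1 if p ≡ 1 (mod 4) and η_p = i if p ≡ 3 (mod 4), and let s be an integer with p ∤ s. Then Σ_{u=0}^{p−1} e^{2πi u² s/p} = (s|p)·η_p·√p (note that (s⁻¹|p) = (s|p)). -/
open Polynomial in
lemma tq_iter {p : ℕ} [Fact p.Prime] (m : ℕ) (hm : p = 2 * m + 1) (j : ℕ) (hj : j ≤ m) :
    ∃ h : (ZMod p)[X], ∑ i ∈ Finset.range p, C ((i : ZMod p) ^ j) * X ^ i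
      = (X - 1) ^ (2 * m - j) * h ∧ h.eval 1 = ∏ i ∈ Finset.range j, (-((i : ZMod p) + 1)) := by
  induction j with
  | zero =>
    refine ⟨1, ?_, by simp⟩
    have h1 : (X - 1 : (ZMod p)[X]) ≠ 0 := by
      simpa using X_sub_C_ne_zero (1 : ZMod p)
    apply mul_right_cancel₀ h1
    simp only [pow_zero, map_one, one_mul, mul_one, Nat.sub_zero]
    rw [geom_sum_mul, ← pow_succ, ← hm, sub_pow_char, one_pow]
  | succ j ih =>
    obtain ⟨h, h1, h2⟩ := ih (by omega)
    obtain ⟨n, hn⟩ : ∃ n, 2 * m - j = n + 1 := ⟨2 * m - j - 1, by omega⟩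
    have hn' : 2 * m - (j + 1) = n := by omega
    have hc : ((n : ZMod p) + 1) = -((j : ZMod p) + 1) := by
      have : ((n + 1 + (j + 1) : ℕ) : ZMod p) = 0 := by
        rw [show n + 1 + (j + 1) = p by omega]; simp
      push_cast at this
      linear_combination this
    refine ⟨X * (C ((n : ZMod p) + 1) * h + (X - 1) * derivative h), ?_, ?_⟩
    · have := congrArg (fun f => X * derivative f) h1
      rw [hn] at this
      simp only [derivative_sum, derivative_mul, derivative_C, zero_mul, zero_add,
        Finset.mul_sum, derivative_pow, derivative_sub, derivative_X, derivative_one, mul_one] at this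
      rw [hn']
      have e : ∀ i ∈ Finset.range p, (C ((i : ZMod p) ^ (j + 1)) * X ^ i : (ZMod p)[X])
          = X * (C ((i : ZMod p) ^ j) * (C (i : ZMod p) * X ^ (i - 1))) := by
        intro i _
        rcases i with _ | i
        · simp
        · simp [pow_succ]; ring
      rw [Finset.sum_congr rfl e, this]
      simp
      ring
    · rw [Finset.prod_range_succ, ← h2, ← hc]
      simp
      ring

open Polynomial in
lemma tq_prod {p : ℕ} [Fact p.Prime] (m n : ℕ) (hm : p = 2 * m + 1) (hn : n ≤ m) :
    ∃ h : (ZMod p)[X], ∏ k ∈ Finset.range n, (X ^ (k + 1) - X ^ (2 * m - k) : (ZMod p)[X])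
      = (X - 1) ^ n * h ∧ h.eval 1 = ∏ i ∈ Finset.range n, (2 * ((i : ZMod p) + 1)) := by
  induction n with
  | zero => exact ⟨1, by simp, by simp⟩
  | succ n ih =>
    obtain ⟨h, h1, h2⟩ := ih (by omega)
    refine ⟨h * (∑ i ∈ Finset.range (n + 1), X ^ i - ∑ i ∈ Finset.range (2 * m - n), X ^ i),
      ?_, ?_⟩
    · rw [Finset.prod_range_succ, h1]
      have a1 := geom_sum_mul (X : (ZMod p)[X]) (n + 1)
      have a2 := geom_sum_mul (X : (ZMod p)[X]) (2 * m - n)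
      linear_combination (-(X - 1) ^ n * h) * (a1 - a2)
    · rw [Finset.prod_range_succ, ← h2]
      have hc : ((2 * m - n : ℕ) : ZMod p) = -((n : ZMod p) + 1) := by
        have : ((2 * m - n + (n + 1) : ℕ) : ZMod p) = 0 := by
          rw [show 2 * m - n + (n + 1) = p by omega]; simp
        rw [Nat.cast_add] at this
        push_cast at this
        linear_combination this
      simp [eval_finsetSum, hc]
      left; ring

open Polynomial in
lemma tq_eps {p : ℕ} [Fact p.Prime] (m : ℕ) (hm : p = 2 * m + 1) (ε : ℤ) (ζ : ℂ)
    (hζ : IsPrimitiveRoot ζ p)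
    (h : ∑ i ∈ Finset.range p, (legendreSym p i : ℂ) * ζ ^ i
      = ε * ∏ k ∈ Finset.range m, (ζ ^ (k + 1) - ζ ^ (2 * m - k))) :
    ((-1) ^ m : ZMod p) = ε * 2 ^ m := by
  have hpp : p.Prime := Fact.out
  have hm0 : 0 < m := by have := hpp.two_le; omega
  let F : ℤ[X] := ∑ i ∈ Finset.range p, C (legendreSym p i) * X ^ i
    - C ε * ∏ k ∈ Finset.range m, (X ^ (k + 1) - X ^ (2 * m - k))
  have hF : aeval ζ F = 0 := by
    simp [F, map_prod, h]
  have hd := minpoly.isIntegrallyClosed_dvd (hζ.isIntegral hpp.pos) hF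
  rw [← cyclotomic_eq_minpoly hζ hpp.pos] at hd
  obtain ⟨G, hG⟩ := hd
  have hG' := congrArg (map (Int.castRingHom (ZMod p))) hG
  rw [Polynomial.map_mul, map_cyclotomic_int, cyclotomic_prime] at hG'
  obtain ⟨a0, ha0, hb0⟩ := tq_iter (p := p) m hm 0 (by omega)
  obtain ⟨a, ha, hb⟩ := tq_iter (p := p) m hm m le_rfl
  obtain ⟨c, hc, hd⟩ := tq_prod (p := p) m m hm le_rfl
  simp only [pow_zero, map_one, one_mul, Nat.sub_zero] at ha0
  have hl : ∀ i : ℕ, ((legendreSym p i : ℤ) : ZMod p) = (i : ZMod p) ^ m := by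
    intro i
    rw [legendreSym.eq_pow, show p / 2 = m by omega]; simp
  simp only [F, Polynomial.map_sub, Polynomial.map_mul, Polynomial.map_sum, Polynomial.map_prod,
    Polynomial.map_pow, map_X, map_C] at hG'
  simp only [eq_intCast (Int.castRingHom (ZMod p)), hl] at hG'
  rw [ha, hc, ha0, show 2 * m - m = m by omega] at hG'
  have h1 : (X - 1 : (ZMod p)[X]) ^ m ≠ 0 := by
    apply pow_ne_zero
    simpa using X_sub_C_ne_zero (1 : ZMod p)
  have h2 : a - C (ε : ZMod p) * c = (X - 1) ^ m * (a0 * G.map (Int.castRingHom (ZMod p))) := by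
    apply mul_left_cancel₀ h1
    rw [two_mul, pow_add] at hG'
    linear_combination hG'
  have h3 := congrArg (eval 1) h2
  rw [Finset.prod_neg, Finset.card_range] at hb
  simp [hb, hd, hm0.ne', Finset.prod_mul_distrib] at h3
  have h4 : ∏ i ∈ Finset.range m, ((i : ZMod p) + 1) ≠ 0 := by
    rw [Finset.prod_ne_zero_iff]
    intro i hi
    have := Finset.mem_range.1 hi
    rw [← Nat.cast_succ, Ne, ZMod.natCast_eq_zero_iff]
    exact Nat.not_dvd_of_pos_of_lt (by omega) (by omega)
  apply mul_right_cancel₀ h4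
  linear_combination h3

lemma tq_P {p : ℕ} [Fact p.Prime] (m : ℕ) (hm : p = 2 * m + 1) (ζ : ℂ)
    (hζe : ζ = Complex.exp (2 * Real.pi * Complex.I / p)) (hζ : IsPrimitiveRoot ζ p) :
    ∏ k ∈ Finset.range m, (ζ ^ (k + 1) - ζ ^ (2 * m - k)) = Complex.I ^ m * Real.sqrt p := by
  have hpp : p.Prime := Fact.out
  have hp0 : (p : ℝ) ≠ 0 := by exact_mod_cast hpp.ne_zero
  let R : ℝ := ∏ k ∈ Finset.range m, 2 * Real.sin (2 * Real.pi * (k + 1) / p)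
  have hP : ∏ k ∈ Finset.range m, (ζ ^ (k + 1) - ζ ^ (2 * m - k)) = Complex.I ^ m * R := by
    simp only [R]
    push_cast
    rw [← Finset.card_range m, ← Finset.prod_const, Finset.card_range, ← Finset.prod_mul_distrib]
    refine Finset.prod_congr rfl fun k hk => ?_
    have hk := Finset.mem_range.1 hk
    have e1 : ζ ^ (2 * m - k) = (ζ ^ (k + 1))⁻¹ := by
      apply eq_inv_of_mul_eq_one_left
      rw [← pow_add, show 2 * m - k + (k + 1) = p by omega, hζ.pow_eq_one]
    have e2 : ζ ^ (k + 1) = Complex.exp ((2 * Real.pi * (k + 1) / p) * Complex.I) := by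
      rw [hζe, ← Complex.exp_nat_mul]
      congr 1
      push_cast; ring
    rw [e1, e2, ← Complex.exp_neg, Complex.sin]
    ring_nf
    rw [Complex.I_sq]
    ring
  have hR : 0 < R := by
    apply Finset.prod_pos
    intro k hk
    have hk := Finset.mem_range.1 hk
    have hpos : (0 : ℝ) < p := by exact_mod_cast hpp.pos
    apply mul_pos two_pos
    apply Real.sin_pos_of_pos_of_lt_pi
    · positivity
    · rw [div_lt_iff₀ hpos]
      have : (2 * (k + 1) : ℝ) < p := by
        have : 2 * (k + 1) < p := by omega
        exact_mod_cast this
      nlinarith [Real.pi_pos]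
  have hsq : (∏ k ∈ Finset.range m, (ζ ^ (k + 1) - ζ ^ (2 * m - k))) ^ 2 = (-1) ^ m * p := by
    have h2 : IsPrimitiveRoot (ζ ^ 2) (2 * m + 1) := by
      rw [← hm]
      apply hζ.pow_of_coprime
      rw [hm]; simp
    have h3 := h2.prod_one_sub_pow_eq_order
    have hp' : (p : ℂ) = (2 * m : ℕ) + 1 := by rw [hm]; push_cast; ring
    rw [hp', ← h3, two_mul, Finset.prod_range_add,
      ← Finset.prod_range_reflect (fun x => 1 - (ζ ^ 2) ^ (m + x + 1)),
      ← Finset.prod_mul_distrib, ← Finset.prod_pow]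
    rw [← Finset.card_range m, ← Finset.prod_const, Finset.card_range, ← Finset.prod_mul_distrib]
    refine Finset.prod_congr rfl fun k hk => ?_
    have hk := Finset.mem_range.1 hk
    have e1 : ζ ^ (m + m - k) * ζ ^ (k + 1) = 1 := by
      rw [← pow_add, show m + m - k + (k + 1) = p by omega, hζ.pow_eq_one]
    rw [show m + (m - 1 - k) + 1 = m + m - k by omega, ← pow_mul, ← pow_mul, mul_comm 2, mul_comm 2,
      pow_mul, pow_mul]
    linear_combination (ζ ^ (m + m - k) * ζ ^ (k + 1) - 1) * e1
  rw [hP]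
  have : R = Real.sqrt p := by
    symm
    rw [Real.sqrt_eq_iff_mul_self_eq (by positivity) hR.le]
    rw [hP, mul_pow, ← pow_mul, mul_comm m, pow_mul, Complex.I_sq] at hsq
    have := mul_left_cancel₀ (pow_ne_zero m (by norm_num)) hsq
    rw [← pow_two]
    exact_mod_cast this.symm
  rw [this]

lemma tq_sign {p : ℕ} [Fact p.Prime] (m : ℕ) (hm : p = 2 * m + 1) (ε : ℤ) (hε : ε = 1 ∨ ε = -1)
    (h : ((-1) ^ m : ZMod p) = ε * 2 ^ m) :
    (ε : ℂ) * Complex.I ^ m = if p % 4 = 1 then 1 else Complex.I := by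
  have hpp : p.Prime := Fact.out
  have hp2 : p ≠ 2 := by omega
  have h2 := legendreSym.eq_pow p 2
  rw [show p / 2 = m by omega, legendreSym.at_two hp2, ZMod.χ₈_nat_eq_if_mod_eight] at h2
  rw [Int.cast_ofNat] at h2
  rw [← h2] at h
  have h3 : ((2 : ℕ) : ZMod p) ≠ 0 := by
    rw [Ne, ZMod.natCast_eq_zero_iff]
    exact fun hd => by have := Nat.le_of_dvd two_pos hd; have := hpp.two_le; omega
  have hne : (1 : ZMod p) ≠ -1 := by
    intro h; apply h3; push_cast; linear_combination h
  have hmm : m = 4 * (m / 4) + m % 4 := by omega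
  have hI : Complex.I ^ m = Complex.I ^ (m % 4) := by
    conv_lhs => rw [hmm, pow_add, pow_mul, Complex.I_pow_four, one_pow, one_mul]
  have hJ : ((-1) ^ m : ZMod p) = (-1) ^ (m % 4) := by
    conv_lhs => rw [hmm, pow_add, pow_mul, show ((-1) ^ 4 : ZMod p) = 1 by ring, one_pow, one_mul]
  rw [hI]
  rw [hJ] at h
  have h4 : m % 4 < 4 := Nat.mod_lt _ (by norm_num)
  have c1 : p % 2 = 1 := by omega
  have c2 : p % 8 = 2 * (m % 4) + 1 := by omega
  have c3 : p % 4 = (2 * (m % 4) + 1) % 4 := by omega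
  rw [c1, c2] at h
  rw [c3]
  have hne' := hne.symm
  clear c1 c2 c3 hJ hI hmm h3 h2
  generalize m % 4 = r at h h4 ⊢
  interval_cases r <;> rcases hε with rfl | rfl <;>
    simp [pow_succ, hne, hne'] at h ⊢

lemma tq_gauss {p : ℕ} [Fact p.Prime] (hp : Odd p) :
    ∑ i ∈ Finset.range p, (legendreSym p i : ℂ) * Complex.exp (2 * Real.pi * Complex.I / p) ^ i
     = (if p % 4 = 1 then 1 else Complex.I) * Real.sqrt p ∧
    ∀ s : ℤ, ¬ (p : ℤ) ∣ s → 
    ∑ u ∈ Finset.range p, Complex.exp (2 * Real.pi * Complex.I * (u : ℂ) ^ 2 * s / p)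
     = legendreSym p s * ∑ i ∈ Finset.range p, (legendreSym p i : ℂ) * Complex.exp (2 * Real.pi * Complex.I / p) ^ i := by
  have hpp : p.Prime := Fact.out
  obtain ⟨m, hm⟩ := hp
  have hp2 : p ≠ 2 := by omega
  have hr : ringChar (ZMod p) ≠ 2 := by rwa [ZMod.ringChar_zmod_n]
  have hsumN : ∀ f : ZMod p → ℂ, ∑ a, f a = ∑ i ∈ Finset.range p, f (i : ZMod p) := by
    intro f
    symm
    refine Finset.sum_nbij' (fun i => (i : ZMod p)) (fun a => a.val) ?_ ?_ ?_ ?_ ?_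
    · simp
    · intro a _; simpa using ZMod.val_lt a
    · intro i hi; exact ZMod.val_cast_of_lt (Finset.mem_range.1 hi)
    · intro a _; simp
    · simp
  let χ : MulChar (ZMod p) ℂ := (quadraticChar (ZMod p)).ringHomComp (Int.castRingHom ℂ)
  let ψ : AddChar (ZMod p) ℂ := ZMod.stdAddChar
  have hψ : ψ.IsPrimitive := ZMod.isPrimitive_stdAddChar p
  have hχ2 : χ.IsQuadratic := (quadraticChar_isQuadratic (ZMod p)).comp _
  have hχ1 : χ ≠ 1 := by
    apply (MulChar.ringHomComp_ne_one_iff (RingHom.injective_int _)).2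
    exact quadraticChar_ne_one hr
  have hχ : ∀ a : ℤ, χ (a : ZMod p) = legendreSym p a := fun a => by
    simp [χ, legendreSym]
  have hg : gaussSum χ ψ = ∑ i ∈ Finset.range p,
      (legendreSym p i : ℂ) * Complex.exp (2 * Real.pi * Complex.I / p) ^ i := by
    rw [gaussSum, hsumN]
    refine Finset.sum_congr rfl fun i _ => ?_
    have h1 := hχ i
    have h2 := ZMod.stdAddChar_coe (N := p) i
    rw [Int.cast_natCast] at h1 h2
    rw [h1, show ψ i = _ from h2, ← Complex.exp_nat_mul]
    congr 2
    push_cast; ring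
  have hζ : IsPrimitiveRoot (Complex.exp (2 * Real.pi * Complex.I / p)) p :=
    Complex.isPrimitiveRoot_exp p hpp.ne_zero
  rw [← hg]
  constructor
  · have hsq := gaussSum_sq hχ1 hχ2 hψ
    have hP := tq_P m hm _ rfl hζ
    have hneg : χ (-1) = (-1) ^ m := by
      have := hχ (-1)
      rw [legendreSym.at_neg_one hp2, ZMod.χ₄_eq_neg_one_pow (by omega),
        show p / 2 = m by omega] at this
      push_cast at this
      exact this
    have : gaussSum χ ψ ^ 2 = (Complex.I ^ m * Real.sqrt p) ^ 2 := by
      rw [hsq, hneg, mul_pow, ← pow_mul, mul_comm m, pow_mul, Complex.I_sq, ZMod.card,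
        ← Complex.ofReal_pow, Real.sq_sqrt (by positivity)]
      simp
    have : ∃ ε : ℤ, (ε = 1 ∨ ε = -1) ∧ gaussSum χ ψ = ε * (Complex.I ^ m * Real.sqrt p) := by
      rcases sq_eq_sq_iff_eq_or_eq_neg.1 this with h | h
      · exact ⟨1, by simp, by simp [h]⟩
      · exact ⟨-1, by simp, by simp [h]⟩
    obtain ⟨ε, hε, h⟩ := this
    rw [h, ← mul_assoc, tq_sign m hm ε hε]
    rw [← hP, hg] at h
    exact tq_eps m hm ε _ hζ h
  · intro s hs
    have hs0 : (s : ZMod p) ≠ 0 := by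
      rwa [Ne, ZMod.intCast_zmod_eq_zero_iff_dvd]
    have hu := gaussSum_mulShift χ ψ (Units.mk0 (s : ZMod p) hs0)
    rw [Units.val_mk0, hχ] at hu
    have hl : (legendreSym p s : ℂ) * legendreSym p s = 1 := by
      have := legendreSym.sq_one p hs0
      rw [← pow_two]; exact_mod_cast this
    have e1 : ∑ u ∈ Finset.range p, Complex.exp (2 * Real.pi * Complex.I * (u : ℂ) ^ 2 * s / p)
        = ∑ u : ZMod p, ψ (s * u ^ 2) := by
      rw [hsumN]
      refine Finset.sum_congr rfl fun i _ => ?_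
      have h2 := ZMod.stdAddChar_coe (N := p) (s * i ^ 2)
      push_cast at h2
      rw [show ψ _ = _ from h2]
      congr 1; ring
    have e2 : ∑ u : ZMod p, ψ (s * u ^ 2) = ∑ a : ZMod p, (χ a + 1) * ψ (s * a) := by
      rw [← Finset.sum_fiberwise (s := Finset.univ) (g := fun u : ZMod p => u ^ 2)]
      refine Finset.sum_congr rfl fun a _ => ?_
      rw [Finset.sum_congr rfl (g := fun _ => ψ (s * a))
        (fun u hu => by rw [(Finset.mem_filter.1 hu).2]), Finset.sum_const, nsmul_eq_mul]
      congr 1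
      have := quadraticChar_card_sqrts hr a
      have h' : ((Finset.univ.filter fun u : ZMod p => u ^ 2 = a).card : ℤ)
          = quadraticChar (ZMod p) a + 1 := by
        rw [← this]; congr 2; ext; simp
      have h'' := congrArg (Int.cast : ℤ → ℂ) h'
      push_cast at h''
      rw [h'']
      simp [χ]
    have e3 : ∑ a : ZMod p, ψ (s * a) = 0 := AddChar.sum_eq_zero_of_ne_one (hψ hs0)
    rw [e1, e2]
    simp only [add_mul, one_mul, Finset.sum_add_distrib, e3, add_zero]
    have e4 : gaussSum χ (ψ.mulShift s) = ∑ a : ZMod p, χ a * ψ (s * a) := rfl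
    rw [← e4]
    linear_combination (legendreSym p s : ℂ) * hu - gaussSum χ (ψ.mulShift s) * hl

/-- For an odd prime `p`, `η_p = 1` if `p ≡ 1 (mod 4)` and `η_p = i` if
`p ≡ 3 (mod 4)`, and an integer `s` with `p ∤ s`:
`Σ_{u=0}^{p−1} e^{2πi u² s/p} = (s|p)·η_p·√p`. -/
theorem twisted_quadratic_gauss_sum_eval
    (p : ℕ) [Fact p.Prime] (hp : Odd p) (s : ℤ) (hs : ¬ (p : ℤ) ∣ s) :
    ∑ u ∈ Finset.range p, Complex.exp (2 * Real.pi * Complex.I * (u : ℂ) ^ 2 * s / p)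
      = (legendreSym p s : ℂ) * (if p % 4 = 1 then 1 else Complex.I) * Real.sqrt p := by
  obtain ⟨h1, h2⟩ := tq_gauss hp
  rw [h2 s hs, h1, mul_assoc]
end

section
/- (Carlitz–Peralta) Let p be an odd prime, let k ≥ 1 be an integer, and let ε₀, ε₁, …, ε_{k−1} ∈ {−1, +1}. Let N(k,p) denote the number of u ∈ F_p such that u + i ≢ 0 (mod p) and ((u+i)|p) = ε_i for all 0 ≤ i ≤ k−1. Then N(k,p) = p/2^k + E(k,p) with |E(k,p)| ≤ (k+1)·(3 + √p). -/
open Polynomial in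
/-- iterated twisted derivative -/
noncomputable def stepOp {F : Type*} [Field F] (f : F[X]) (m : F) : ℕ → F[X] →ₗ[F] F[X]
  | 0 => LinearMap.id
  | k + 1 => (LinearMap.mulLeft F f ∘ₗ derivative +
      LinearMap.mulLeft F (C (m - k) * derivative f)) ∘ₗ stepOp f m k

open Polynomial in
theorem stepOp_succ {F : Type*} [Field F] (f : F[X]) (m : F) (k : ℕ) (b : F[X]) :
    stepOp f m (k+1) b = f * derivative (stepOp f m k b) +
      C (m - k) * derivative f * stepOp f m k b := by
  simp [stepOp, mul_assoc]

open Polynomial in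
theorem stepOp_spec {F : Type*} [Field F] (f : F[X]) (n k : ℕ) (b : F[X]) :
    f ^ k * derivative^[k] (b * f ^ n) = f ^ n * stepOp f n k b := by
  induction k with
  | zero => simp [stepOp, mul_comm]
  | succ k ih =>
    have h := congrArg derivative ih
    rw [derivative_mul, derivative_mul, derivative_pow, derivative_pow] at h
    rw [stepOp_succ, Function.iterate_succ_apply']
    have h2 : (f ^ k) * f = f^(k+1) := by ring
    have hk : (C (k:F)) * f ^ (k-1) * f = C (k:F) * f ^ k := by
      cases k with
      | zero => simp
      | succ k => simp; ring
    have hn : (C (n:F)) * f ^ (n-1) * f = C (n:F) * f ^ n := by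
      cases n with
      | zero => simp
      | succ k => simp; ring
    rw [C_sub]
    linear_combination f * h - derivative f * derivative^[k] (b * f ^ n) * hk
      + derivative f * stepOp f n k b * hn - C (k:F) * derivative f * ih

open Polynomial in
theorem stepOp_natDegree {F : Type*} [Field F] (f : F[X]) (m : F) (k : ℕ) (b : F[X]) (A d : ℕ)
    (hd : 1 ≤ d) (hf : f.natDegree ≤ d) (hb : b.natDegree ≤ A) :
    (stepOp f m k b).natDegree ≤ A + k * (d - 1) := by
  induction k with
  | zero => simpa [stepOp] using hb
  | succ k ih =>
    rw [stepOp_succ]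
    set L := stepOp f m k b
    have hk : A + (k+1) * (d-1) = (A + k * (d-1)) + (d - 1) := by ring
    rw [hk]
    refine (natDegree_add_le _ _).trans (max_le ?_ ?_)
    · by_cases h0 : L.natDegree = 0
      · rw [derivative_of_natDegree_zero h0]; simp
      · refine natDegree_mul_le.trans ?_
        have := natDegree_derivative_le L
        omega
    · refine natDegree_mul_le.trans ?_
      have h1 : (C (m - k) * derivative f).natDegree ≤ d - 1 := by
        refine (natDegree_C_mul_le _ _).trans ?_
        have := natDegree_derivative_le f
        omega
      omega

open Polynomial in
theorem step_nonvanish (p : ℕ) [Fact p.Prime] (hp : Odd p) (f : (ZMod p)[X]) (c : ZMod p)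
    (hc : f.rootMultiplicity c = 1) (h0 : f.coeff 0 ≠ 0)
    (a b : (ZMod p)[X]) (ha : 2 * a.natDegree + f.natDegree < p) (hb : 2 * b.natDegree < p)
    (h : X ^ p ∣ a + b * f ^ ((p-1)/2)) : a = 0 ∧ b = 0 := by
  have hf : f ≠ 0 := by rintro rfl; simp at h0
  have hfp : f ^ p = expand (ZMod p) p f := by
    rw [ZMod.expand_card]
  have h1 : X ^ p ∣ f ^ p - C (f.coeff 0) := by
    rw [hfp]
    have : (X : (ZMod p)[X]) ∣ f - C (f.coeff 0) := by
      rw [X_dvd_iff]; simp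
    have := map_dvd (expand (ZMod p) p) this
    simpa using this
  have h2 : X ^ p ∣ a^2 * f - C (f.coeff 0) * b^2 := by
    have e : f ^ p = (f ^ ((p-1)/2))^2 * f := by
      rw [← pow_mul, ← pow_succ]
      congr 1
      obtain ⟨m, rfl⟩ := hp; omega
    have : a^2 * f - C (f.coeff 0) * b^2 = (a + b * f ^ ((p-1)/2)) * ((a - b * f ^ ((p-1)/2)) * f)
      + b^2 * (f ^ p - C (f.coeff 0)) := by rw [e]; ring
    rw [this]
    exact dvd_add (h.mul_right _) (h1.mul_left _)
  have h3 : a^2 * f = C (f.coeff 0) * b^2 := by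
    rw [← sub_eq_zero]
    refine eq_zero_of_dvd_of_natDegree_lt h2 ?_
    rw [natDegree_X_pow]
    refine lt_of_le_of_lt (natDegree_sub_le _ _) (max_lt ?_ ?_)
    · refine lt_of_le_of_lt (natDegree_mul_le.trans (Nat.add_le_add_right natDegree_pow_le _)) ha
    · refine lt_of_le_of_lt ((natDegree_C_mul_le _ _).trans natDegree_pow_le) hb
  have hb0 : b = 0 := by
    by_contra hb0
    have ha0 : a ≠ 0 := by
      rintro rfl
      simp [h0, hb0] at h3
    have h4 := congrArg (rootMultiplicity c) h3
    rw [rootMultiplicity_mul (by positivity), rootMultiplicity_mul (by simp [h0, hb0]),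
      pow_two, pow_two, rootMultiplicity_mul (by positivity), rootMultiplicity_mul (by positivity),
      rootMultiplicity_C, hc] at h4
    omega
  subst hb0
  simp [hf] at h3
  exact ⟨h3, rfl⟩

open Polynomial in
theorem step_sum_nonvanish (p : ℕ) [Fact p.Prime] (hp : Odd p) (f : (ZMod p)[X]) (c : ZMod p)
    (hc : f.rootMultiplicity c = 1) (h0 : f.coeff 0 ≠ 0) (J A : ℕ)
    (hA : 2 * A + f.natDegree < p)
    (a b : ℕ → (ZMod p)[X]) (ha : ∀ j, (a j).natDegree ≤ A) (hb : ∀ j, (b j).natDegree ≤ A)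
    (h : ∑ j ∈ Finset.range J, (a j + b j * f ^ ((p-1)/2)) * X ^ (j * p) = 0) :
    ∀ j < J, a j = 0 ∧ b j = 0 := by
  induction J generalizing a b with
  | zero => simp
  | succ J ih =>
    rw [Finset.sum_range_succ'] at h
    have e : ∑ j ∈ Finset.range J, (a (j+1) + b (j+1) * f ^ ((p-1)/2)) * X ^ ((j+1) * p)
        = X ^ p * ∑ j ∈ Finset.range J, (a (j+1) + b (j+1) * f ^ ((p-1)/2)) * X ^ (j * p) := by
      rw [Finset.mul_sum]
      refine Finset.sum_congr rfl fun j _ => ?_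
      ring
    rw [e] at h
    have hd : X ^ p ∣ a 0 + b 0 * f ^ ((p-1)/2) := by
      refine ⟨-∑ j ∈ Finset.range J, (a (j+1) + b (j+1) * f ^ ((p-1)/2)) * X ^ (j * p), ?_⟩
      simp only [zero_mul, pow_zero, mul_one] at h
      linear_combination h
    have h00 := step_nonvanish p hp f c hc h0 (a 0) (b 0)
      (by have := ha 0; omega) (by have := hb 0; omega) hd
    have h' := ih (fun j => a (j+1)) (fun j => b (j+1)) (fun j => ha _) (fun j => hb _) (by
      rw [h00.1, h00.2] at h
      have hX : (X : (ZMod p)[X]) ^ p ≠ 0 := pow_ne_zero _ X_ne_zero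
      simpa [hX] using h)
    intro j hj
    cases j with
    | zero => exact h00
    | succ j => exact h' j (by omega)

open Polynomial in
theorem step_exists {F : Type*} [Field F] (f : F[X]) (m e : F) (A J M d : ℕ)
    (hd : 1 ≤ d) (hf : f.natDegree ≤ d)
    (hcount : ∑ k ∈ Finset.range M, (A + k * (d - 1) + J + 1) < (J + 1) * (2 * (A + 1))) :
    ∃ a b : ℕ → F[X], (∀ j, (a j).natDegree ≤ A) ∧ (∀ j, (b j).natDegree ≤ A) ∧
      (∃ j < J + 1, a j ≠ 0 ∨ b j ≠ 0) ∧
      ∀ k < M, ∑ j ∈ Finset.range (J + 1),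
        (stepOp f 0 k (a j) + C e * stepOp f m k (b j)) * X ^ j = 0 := by
  classical
  let V := (Fin (J+1) × Bool) → degreeLT F (A+1)
  let n : Fin M → ℕ := fun k => A + (k:ℕ) * (d - 1) + J + 1
  let Q : ℕ → V →ₗ[F] F[X] := fun k => ∑ j : Fin (J+1), LinearMap.mulRight F (X^(j:ℕ)) ∘ₗ
    (stepOp f 0 k ∘ₗ (degreeLT F (A+1)).subtype ∘ₗ LinearMap.proj (j,false) +
      e • (stepOp f m k ∘ₗ (degreeLT F (A+1)).subtype ∘ₗ LinearMap.proj (j,true)))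
  let Φ : V →ₗ[F] ((Σ k : Fin M, Fin (n k)) → F) :=
    LinearMap.pi fun ki => (lcoeff F (ki.2:ℕ)) ∘ₗ Q (ki.1:ℕ)
  have : Module.Finite F (degreeLT F (A+1)) := Module.Finite.equiv (degreeLTEquiv F (A+1)).symm
  have hV : Module.finrank F V = (J+1) * (2 * (A+1)) := by
    have : Module.finrank F (degreeLT F (A+1)) = A + 1 := by
      rw [(degreeLTEquiv F (A+1)).finrank_eq, Module.finrank_fin_fun]
    simp only [V]
    rw [Module.finrank_pi_fintype]
    simp [this]; ring
  have hW : Module.finrank F ((Σ k : Fin M, Fin (n k)) → F)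
      = ∑ k ∈ Finset.range M, (A + k * (d - 1) + J + 1) := by
    rw [Module.finrank_fintype_fun_eq_card, Fintype.card_sigma, Finset.sum_range]
    simp [n]
  have hker : LinearMap.ker Φ ≠ ⊥ := LinearMap.ker_ne_bot_of_finrank_lt (by rw [hV, hW]; exact hcount)
  obtain ⟨v, hv, hv0⟩ := Submodule.exists_mem_ne_zero_of_ne_bot hker
  let g : Bool → ℕ → F[X] := fun t j => if h : j < J + 1 then (v (⟨j, h⟩, t) : F[X]) else 0
  have hgpos : ∀ t j (h : j < J + 1), g t j = (v (⟨j, h⟩, t) : F[X]) := fun t j h => dif_pos h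
  have hgneg : ∀ t j, ¬ (j < J + 1) → g t j = 0 := fun t j h => dif_neg h
  have hg : ∀ t j, (g t j).natDegree ≤ A := by
    intro t j
    by_cases h : j < J + 1
    · rw [hgpos t j h]
      have := mem_degreeLT.1 (v (⟨j, h⟩, t)).2
      exact natDegree_le_of_degree_le (by
        rw [degree_lt_iff_coeff_zero] at this
        rw [degree_le_iff_coeff_zero]
        intro m hm
        exact this m (by exact_mod_cast hm))
    · simp [hgneg t j h]
  refine ⟨g false, g true, hg _, hg _, ?_, ?_⟩
  · by_contra hcon
    push Not at hcon
    apply hv0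
    funext ⟨⟨j, hj⟩, t⟩
    have := hcon j hj
    apply Subtype.ext
    cases t
    · rw [← hgpos false j hj, this.1]; rfl
    · rw [← hgpos true j hj, this.2]; rfl
  · intro k hk
    have hQ : Q k v = ∑ j ∈ Finset.range (J + 1),
        (stepOp f 0 k (g false j) + C e * stepOp f m k (g true j)) * X ^ j := by
      rw [Finset.sum_range]
      have h1 : ∀ (t : Bool) (j : Fin (J+1)), g t (j:ℕ) = (v (j, t) : F[X]) :=
        fun t j => hgpos t j j.2
      simp only [h1]
      simp [Q, smul_eq_C_mul]
      rfl
    rw [← hQ]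
    ext i
    by_cases hi : i < n ⟨k, hk⟩
    · have := congrFun (LinearMap.mem_ker.1 hv) ⟨⟨k, hk⟩, ⟨i, hi⟩⟩
      simpa [Φ] using this
    · rw [coeff_zero]
      apply coeff_eq_zero_of_natDegree_lt
      rw [hQ]
      refine lt_of_le_of_lt (natDegree_sum_le_of_forall_le (n := A + k * (d - 1) + J) _ _ ?_) ?_
      · intro j hj
        refine natDegree_mul_le.trans ?_
        rw [natDegree_X_pow]
        have h1 : (stepOp f 0 k (g false j) + C e * stepOp f m k (g true j)).natDegree
            ≤ A + k * (d-1) := by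
          refine (natDegree_add_le _ _).trans (max_le ?_ ((natDegree_C_mul_le _ _).trans ?_))
          · exact stepOp_natDegree f _ k _ A d hd hf (hg _ _)
          · exact stepOp_natDegree f _ k _ A d hd hf (hg _ _)
        have := Finset.mem_range.1 hj
        omega
      · simp only [n] at hi; omega

open Polynomial in
theorem iter_deriv_mul_X_pow (p : ℕ) [Fact p.Prime] (q : (ZMod p)[X]) (j k : ℕ) :
    derivative^[k] (q * X ^ (j * p)) = derivative^[k] q * X ^ (j * p) := by
  induction k with
  | zero => simp
  | succ k ih =>
    rw [Function.iterate_succ_apply', ih, Function.iterate_succ_apply', derivative_mul]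
    have : derivative (X ^ (j * p) : (ZMod p)[X]) = 0 := by
      rw [derivative_X_pow]; simp
    rw [this]; simp

open Polynomial in
theorem stepanov_bound (p : ℕ) [Fact p.Prime] (hp : Odd p) (f : (ZMod p)[X]) (c : ZMod p)
    (hc : f.rootMultiplicity c = 1) (h0 : f.coeff 0 ≠ 0) (e : ZMod p) (A J M d : ℕ)
    (hd : 1 ≤ d) (hf : f.natDegree = d) (hA : 2 * A + d < p) (hM : M ≤ p)
    (hcount : ∑ k ∈ Finset.range M, (A + k * (d - 1) + J + 1) < (J + 1) * (2 * (A + 1)))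
    (R : Finset (ZMod p)) (hR : ∀ r ∈ R, f.eval r ≠ 0 ∧ (f.eval r) ^ ((p-1)/2) = e) :
    M * R.card ≤ A + d * ((p-1)/2) + J * p := by
  obtain ⟨a, b, ha, hb, ⟨j0, hj0, hne⟩, hk⟩ :=
    step_exists f (((p-1)/2 : ℕ) : ZMod p) e A J M d hd hf.le hcount
  set P := ∑ j ∈ Finset.range (J+1), (a j + b j * f ^ ((p-1)/2)) * X ^ (j * p) with hP
  have hP0 : P ≠ 0 := by
    intro h
    have := step_sum_nonvanish p hp f c hc h0 (J+1) A (by omega) a b ha hb h j0 hj0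
    tauto
  have hroot : ∀ r ∈ R, ∀ k < M, (derivative^[k] P).IsRoot r := by
    intro r hr k hkM
    obtain ⟨hr0, hre⟩ := hR r hr
    have h1 : f ^ k * derivative^[k] P = ∑ j ∈ Finset.range (J+1),
        (stepOp f 0 k (a j) + f ^ ((p-1)/2) * stepOp f (((p-1)/2 : ℕ) : ZMod p) k (b j))
          * X ^ (j * p) := by
      rw [hP, iterate_derivative_sum, Finset.mul_sum]
      refine Finset.sum_congr rfl fun j _ => ?_
      rw [iter_deriv_mul_X_pow, iterate_map_add, ← stepOp_spec f ((p-1)/2) k (b j)]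
      have h2 := stepOp_spec f 0 k (a j)
      simp only [pow_zero, mul_one, one_mul, Nat.cast_zero] at h2
      rw [← h2]
      ring
    have h2 := congrArg (eval r) h1
    have h3 := congrArg (eval r) (hk k hkM)
    simp only [eval_finsetSum, eval_mul, eval_add, eval_pow, eval_X, eval_C, eval_zero, hre,
      mul_comm _ p, pow_mul, ZMod.pow_card] at h2 h3
    rw [h3] at h2
    exact (mul_eq_zero.1 h2).resolve_left (pow_ne_zero _ hr0)
  have hdvd : ∏ r ∈ R, (X - C r) ^ M ∣ P := by
    refine Finset.prod_dvd_of_coprime ?_ ?_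
    · intro x _ y _ hxy
      exact (pairwise_coprime_X_sub_C (fun _ _ h => h) hxy).pow
    · intro r hr
      rcases Nat.eq_zero_or_pos M with h | h
      · simp [h]
      · refine (pow_dvd_pow _ ?_).trans (pow_rootMultiplicity_dvd P r)
        have := lt_rootMultiplicity_of_isRoot_iterate_derivative_of_mem_nonZeroDivisors
          (p := P) (t := r) (n := M - 1) hP0 (fun m hm => hroot r hr m (by omega)) (by
            rw [mem_nonZeroDivisors_iff_ne_zero]
            intro h
            rw [ZMod.natCast_eq_zero_iff, (Fact.out : p.Prime).dvd_factorial] at h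
            omega)
        omega
  have hdeg := natDegree_le_of_dvd hdvd hP0
  rw [natDegree_prod_of_monic _ _ (fun r _ => (monic_X_sub_C r).pow M)] at hdeg
  simp only [natDegree_pow, natDegree_X_sub_C, mul_one, Finset.sum_const, smul_eq_mul] at hdeg
  rw [mul_comm]
  refine hdeg.trans (natDegree_sum_le_of_forall_le _ _ fun j hj => ?_)
  refine natDegree_mul_le.trans ?_
  rw [natDegree_X_pow]
  refine Nat.add_le_add ((natDegree_add_le _ _).trans (max_le ((ha j).trans (by omega)) ?_)) ?_
  · refine natDegree_mul_le.trans (Nat.add_le_add (hb j) (natDegree_pow_le.trans ?_))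
    rw [hf, mul_comm]
  · exact Nat.mul_le_mul_right _ (by have := Finset.mem_range.1 hj; omega)

theorem step_sum_aux (A J D M : ℕ) :
    2 * (∑ k ∈ Finset.range M, (A + k * D + J + 1)) + D * M = M * (2 * (A + J + 1)) + D * (M * M) := by
  induction M with
  | zero => simp
  | succ M ih => rw [Finset.sum_range_succ]; linarith

open Polynomial in
theorem stepanov_count (p : ℕ) [Fact p.Prime] (hp : Odd p) (T : Finset (ZMod p)) (hT : T.Nonempty)
    (h0 : (0 : ZMod p) ∉ T) (e : ℤ) (M : ℕ) (hM : 1 ≤ M)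
    (hMd : Even (M + T.card)) (hMp : M * M + T.card ≤ p) :
    M * (2 * (Finset.univ.filter fun u : ZMod p => ∏ c ∈ T, (u + c) ≠ 0 ∧
      quadraticChar (ZMod p) (∏ c ∈ T, (u + c)) = e).card) + p ≤ M * p + 2 * T.card * p := by
  classical
  set d := T.card with hd
  have hd1 : 1 ≤ d := Finset.card_pos.2 hT
  set f : (ZMod p)[X] := ∏ c ∈ T, (X - C (-c)) with hf
  obtain ⟨c0, hc0⟩ := hT
  have hev : ∀ u, f.eval u = ∏ c ∈ T, (u + c) := by
    intro u; simp [hf, eval_prod]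
  have hmult : f.rootMultiplicity (-c0) = 1 := by
    rw [hf, ← Finset.mul_prod_erase T _ hc0]
    rw [rootMultiplicity_mul, rootMultiplicity_X_sub_C_self, rootMultiplicity_eq_zero]
    · rw [IsRoot, eval_prod, Finset.prod_eq_zero_iff]
      push Not
      intro c hc h
      simp at h
      have : c = c0 := by linear_combination h
      exact (Finset.mem_erase.1 hc).1 this
    · exact mul_ne_zero (X_sub_C_ne_zero _)
        (monic_prod_of_monic _ _ fun c _ => monic_X_sub_C _).ne_zero
  have hdeg : f.natDegree = d := by
    rw [hf, natDegree_prod_of_monic _ _ (fun c _ => monic_X_sub_C _)]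
    simp [hd]
  have hcoeff : f.coeff 0 ≠ 0 := by
    rw [coeff_zero_eq_eval_zero, hev, Finset.prod_ne_zero_iff]
    intro c hc h
    rw [zero_add] at h
    exact h0 (h ▸ hc)
  obtain ⟨J, hJ⟩ : ∃ J, M + d = 2 * (J + 1) := by
    obtain ⟨q, hq⟩ := hMd
    exact ⟨q - 1, by omega⟩
  have hMM : M ≤ M * M := Nat.le_mul_self M
  obtain ⟨A, hA1, hA2⟩ : ∃ A, 2 * A + d + 1 ≤ p ∧ p ≤ 2 * A + 2 + d := ⟨(p - d - 1)/2, by omega, by omega⟩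
  clear_value d
  obtain ⟨D, rfl⟩ : ∃ D, d = D + 1 := ⟨d - 1, by omega⟩
  have hcount : ∑ k ∈ Finset.range M, (A + k * (D + 1 - 1) + J + 1) < (J + 1) * (2 * (A + 1)) := by
    have := step_sum_aux A J D M
    simp only [Nat.add_sub_cancel]
    have h1 : M * M ≤ 2 * A + 2 := by omega
    have hJ' : 2 * J = M + D - 1 := by omega
    zify at *
    have hJ2 : (2:ℤ) * J = M + D - 1 := by linarith
    nlinarith
  have hmain := stepanov_bound p hp f (-c0) hmult hcoeff (e : ZMod p) A J M (D+1) hd1 hdeg (by omega)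
    (by omega) hcount (Finset.univ.filter fun u : ZMod p => ∏ c ∈ T, (u + c) ≠ 0 ∧
      quadraticChar (ZMod p) (∏ c ∈ T, (u + c)) = e) (by
      intro r hr
      rw [Finset.mem_filter] at hr
      rw [hev]
      refine ⟨hr.2.1, ?_⟩
      rw [← hr.2.2, quadraticChar_eq_pow_of_char_ne_two' (by
        rw [ZMod.ringChar_zmod_n]; rintro rfl; exact absurd hp (by decide)), ZMod.card]
      congr 1
      obtain ⟨q, rfl⟩ := hp; omega)
  generalize (Finset.univ.filter fun u : ZMod p => ∏ c ∈ T, (u + c) ≠ 0 ∧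
      quadraticChar (ZMod p) (∏ c ∈ T, (u + c)) = e).card = N at hmain ⊢
  obtain ⟨q, hq⟩ := hp
  have hq2 : (p - 1)/2 = q := by omega
  rw [hq2] at hmain
  have h3 : 2 * (J * p) + 2 * p = (M + D + 1) * p := by
    rw [show M + D + 1 = 2 * (J + 1) by omega]; ring
  have h4 : (D+1) * p = (D+1) * (2 * q) + (D+1) := by rw [hq]; ring
  nlinarith

theorem charsum_aux (p : ℕ) [Fact p.Prime] (hp : Odd p) (T : Finset (ZMod p)) (hT : T.Nonempty)
    (h0 : (0 : ZMod p) ∉ T) (M : ℕ) (hM : 1 ≤ M)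
    (hMd : Even (M + T.card)) (hMp : M * M + T.card ≤ p) :
    (M : ℤ) * |∑ u : ZMod p, quadraticChar (ZMod p) (∏ c ∈ T, (u + c))| ≤
      M * T.card + (2 * T.card - 1) * p := by
  classical
  set R : ℤ → Finset (ZMod p) := fun e => Finset.univ.filter fun u : ZMod p => ∏ c ∈ T, (u + c) ≠ 0 ∧
      quadraticChar (ZMod p) (∏ c ∈ T, (u + c)) = e with hR
  set Z := Finset.univ.filter fun u : ZMod p => ∏ c ∈ T, (u + c) = 0 with hZ
  have hZc : Z.card ≤ T.card := by
    refine le_trans (Finset.card_le_card (t := T.image (fun c => -c)) ?_) Finset.card_image_le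
    intro u hu
    rw [hZ, Finset.mem_filter, Finset.prod_eq_zero_iff] at hu
    obtain ⟨c, hc, h⟩ := hu.2
    exact Finset.mem_image.2 ⟨c, hc, by linear_combination -h⟩
  have key : ∀ u : ZMod p, quadraticChar (ZMod p) (∏ c ∈ T, (u + c)) =
      (if u ∈ R 1 then 1 else 0) - (if u ∈ R (-1) then 1 else 0) ∧
      (1 : ℤ) = (if u ∈ R 1 then 1 else 0) + (if u ∈ R (-1) then 1 else 0) + (if u ∈ Z then 1 else 0) := by
    intro u
    simp only [hR, hZ, Finset.mem_filter, Finset.mem_univ, true_and]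
    by_cases h : ∏ c ∈ T, (u + c) = 0
    · simp [h]
    · rcases quadraticChar_dichotomy h with h' | h' <;> simp [h, h']
  have e1 : ∑ u : ZMod p, quadraticChar (ZMod p) (∏ c ∈ T, (u + c)) = (R 1).card - (R (-1)).card := by
    rw [Finset.sum_congr rfl fun u _ => (key u).1, Finset.sum_sub_distrib]
    simp
  have e2 : (p : ℤ) = (R 1).card + (R (-1)).card + Z.card := by
    have : (p : ℤ) = ∑ u : ZMod p, 1 := by simp
    rw [this, Finset.sum_congr rfl fun u _ => (key u).2, Finset.sum_add_distrib, Finset.sum_add_distrib]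
    simp
  have b1 := stepanov_count p hp T hT h0 1 M hM hMd hMp
  have b2 := stepanov_count p hp T hT h0 (-1) M hM hMd hMp
  change M * (2 * (R 1).card) + p ≤ _ at b1
  change M * (2 * (R (-1)).card) + p ≤ _ at b2
  rw [e1]
  zify at b1 b2 hZc
  have hM0 : (0:ℤ) ≤ M := by positivity
  have := mul_le_mul_of_nonneg_left hZc hM0
  rcases abs_cases (((R 1).card : ℤ) - (R (-1)).card) with ⟨h, _⟩ | ⟨h, _⟩ <;> rw [h] <;> nlinarith

theorem charsum_bound (p : ℕ) [Fact p.Prime] (hp : Odd p) (T : Finset (ZMod p)) (hT : T.Nonempty) :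
    |((∑ u : ZMod p, quadraticChar (ZMod p) (∏ c ∈ T, (u + c)) : ℤ) : ℝ)| ≤
      (2 * T.card + 1) * Real.sqrt p + 4 * T.card + 3 := by
  classical
  have hx2 : Real.sqrt p ^ 2 = p := Real.sq_sqrt (by positivity)
  have hx0 : 0 ≤ Real.sqrt p := Real.sqrt_nonneg _
  set x := Real.sqrt p with hx
  have hd1 : 1 ≤ T.card := Finset.card_pos.2 hT
  have hd1' : (1:ℝ) ≤ T.card := by exact_mod_cast hd1
  by_cases htriv : (p : ℝ) ≤ (2 * T.card + 1) * x + 4 * T.card + 3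
  · refine le_trans ?_ htriv
    have : |∑ u : ZMod p, quadraticChar (ZMod p) (∏ c ∈ T, (u + c))| ≤ (p : ℤ) := by
      refine (Finset.abs_sum_le_sum_abs _ _).trans ?_
      refine (Finset.sum_le_card_nsmul _ _ 1 ?_).trans (by simp)
      intro u _
      by_cases h : ∏ c ∈ T, (u + c) = 0
      · simp [h]
      · rcases quadraticChar_dichotomy h with h' | h' <;> simp [h']
    exact_mod_cast this
  push Not at htriv
  set s := Nat.sqrt p with hs
  have hs1 : s * s ≤ p := Nat.sqrt_le p
  have hs2 : (s : ℝ) ≤ x := by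
    rw [hx]; apply Real.le_sqrt_of_sq_le; rw [pow_two]; exact_mod_cast hs1
  have hs3 : x < s + 1 := by
    rw [hx, Real.sqrt_lt' (by positivity)]
    have := Nat.lt_succ_sqrt p
    rw [pow_two]
    exact_mod_cast this
  have hx4 : 4 < x := by nlinarith
  have hdx : (2 * T.card + 1 : ℝ) < x := by nlinarith
  have hs4 : 4 ≤ s := by
    have : (4:ℝ) < s + 1 := by linarith
    have : 4 < s + 1 := by exact_mod_cast this
    omega
  have hds : 2 * T.card + 1 ≤ s := by
    have : (2 * T.card + 1 : ℝ) < s + 1 := by linarith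
    have : 2 * T.card + 1 < s + 1 := by exact_mod_cast this
    omega
  obtain ⟨M, hM1, hM2, hM3⟩ : ∃ M, s ≤ M + 2 ∧ M + 1 ≤ s ∧ Even (M + T.card) := by
    rcases Nat.even_or_odd (s - 1 + T.card) with h | h
    · exact ⟨s - 1, by omega, by omega, h⟩
    · refine ⟨s - 2, by omega, by omega, ?_⟩
      rw [Nat.odd_iff] at h
      rw [Nat.even_iff]
      omega
  have hMp : M * M + T.card ≤ p := by nlinarith
  -- shift so that zero is not in the set
  obtain ⟨r, hr⟩ : ∃ r, r ∉ T := by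
    by_contra hcon
    push Not at hcon
    have : T.card = p := by
      rw [Finset.eq_univ_of_forall hcon]; simp [ZMod.card]
    nlinarith
  have hinj : Function.Injective (fun c : ZMod p => c - r) := sub_left_injective
  have hb := charsum_aux p hp (T.image (fun c => c - r)) (hT.image _) (by
    intro h
    obtain ⟨c, hc, h⟩ := Finset.mem_image.1 h
    exact hr ((sub_eq_zero.1 h) ▸ hc)) M (by omega)
    (by rwa [Finset.card_image_of_injective _ hinj]) (by rwa [Finset.card_image_of_injective _ hinj])
  rw [Finset.card_image_of_injective _ hinj] at hb
  have hsum : ∑ u : ZMod p, quadraticChar (ZMod p) (∏ c ∈ T.image (fun c => c - r), (u + c)) =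
      ∑ u : ZMod p, quadraticChar (ZMod p) (∏ c ∈ T, (u + c)) := by
    refine Fintype.sum_equiv (Equiv.subRight r) _ _ fun u => ?_
    rw [Finset.prod_image (fun a _ b _ h => hinj h)]
    congr 1
    refine Finset.prod_congr rfl fun c _ => ?_
    simp; ring
  rw [hsum] at hb
  generalize (∑ u : ZMod p, quadraticChar (ZMod p) (∏ c ∈ T, (u + c))) = W at hb ⊢
  have hbR : (M : ℝ) * |(W:ℝ)| ≤ M * T.card + (2 * T.card - 1) * p := by exact_mod_cast hb
  have hMx : x - 3 ≤ M := by
    have : (s : ℝ) ≤ M + 2 := by exact_mod_cast hM1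
    linarith
  have hMpos : (0:ℝ) < M := by linarith
  rw [← hx2] at hbR htriv
  generalize (T.card : ℝ) = d at *
  refine le_of_mul_le_mul_left (hbR.trans ?_) hMpos
  have h5 : (2 * d - 1) * x ^ 2 ≤ (x - 3) * ((2 * d + 1) * x + 3 * d + 3) := by nlinarith
  have h6 : (x - 3) * ((2 * d + 1) * x + 3 * d + 3) ≤ M * ((2 * d + 1) * x + 3 * d + 3) :=
    mul_le_mul_of_nonneg_right hMx (by positivity)
  linarith

theorem sum_card_univ (k : ℕ) : ∑ S : Finset (Fin k), (S.card : ℝ) = k * 2 ^ k / 2 := by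
  have h : ∑ S : Finset (Fin k), (S.card : ℝ) = ∑ S : Finset (Fin k), ((Sᶜ).card : ℝ) :=
    Fintype.sum_equiv (Equiv.ofBijective (fun S : Finset (Fin k) => Sᶜ) compl_bijective) _ _
      (fun S => by simp)
  have h2 : ∑ S : Finset (Fin k), ((S.card : ℝ) + ((Sᶜ).card : ℝ)) = k * 2 ^ k := by
    have : ∀ S : Finset (Fin k), ((S.card : ℝ) + ((Sᶜ).card : ℝ)) = k := by
      intro S
      have := S.card_add_card_compl
      rw [Fintype.card_fin] at this
      exact_mod_cast this
    simp only [this]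
    simp [mul_comm]
  rw [Finset.sum_add_distrib, ← h] at h2
  linarith

theorem pattern_expand (p : ℕ) [Fact p.Prime] (k : ℕ) (ε : Fin k → ℤ) :
    ∑ u : ZMod p, ∏ i : Fin k, (1 + ε i * quadraticChar (ZMod p) (u + ((i : ℕ) : ZMod p))) =
    ∑ S : Finset (Fin k), (∏ i ∈ S, ε i) *
      ∑ u : ZMod p, quadraticChar (ZMod p) (∏ i ∈ S, (u + ((i : ℕ) : ZMod p))) := by
  simp only [Finset.prod_one_add, Finset.powerset_univ]
  rw [Finset.sum_comm]
  refine Finset.sum_congr rfl fun S _ => ?_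
  rw [Finset.mul_sum]
  refine Finset.sum_congr rfl fun u _ => ?_
  rw [Finset.prod_mul_distrib, map_prod]

theorem pattern_charsum (p : ℕ) [Fact p.Prime] (hp : Odd p) (k : ℕ) (hkp : k < p)
    (ε : Fin k → ℤ) (hε : ∀ i, ε i = 1 ∨ ε i = -1) :
    |((∑ u : ZMod p, ∏ i : Fin k, (1 + ε i * quadraticChar (ZMod p) (u + ((i : ℕ) : ZMod p))) : ℤ) : ℝ)
      - p| ≤ 2 ^ k * ((k + 1) * Real.sqrt p + 2 * k + 3) := by
  classical
  have hinj : Function.Injective (fun i : Fin k => ((i : ℕ) : ZMod p)) := by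
    intro i j h
    have := (ZMod.natCast_eq_natCast_iff' _ _ _).1 h
    rw [Nat.mod_eq_of_lt (i.2.trans hkp), Nat.mod_eq_of_lt (j.2.trans hkp)] at this
    exact Fin.ext this
  rw [pattern_expand]
  set B : Finset (Fin k) → ℝ := fun S => (2 * S.card + 1) * Real.sqrt p + 4 * S.card + 3 with hB
  set G : Finset (Fin k) → ℤ := fun S => (∏ i ∈ S, ε i) *
      ∑ u : ZMod p, quadraticChar (ZMod p) (∏ i ∈ S, (u + ((i : ℕ) : ZMod p))) with hG
  have hG0 : G ∅ = p := by simp [hG]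
  have hBG : ∀ S, S ≠ ∅ → |(G S : ℝ)| ≤ B S := by
    intro S hS
    have h1 : |((∏ i ∈ S, ε i : ℤ) : ℝ)| = 1 := by
      rw [Int.cast_prod, Finset.abs_prod]
      refine Finset.prod_eq_one fun i _ => ?_
      rcases hε i with h | h <;> simp [h]
    have h2 := charsum_bound p hp (S.image fun i : Fin k => ((i : ℕ) : ZMod p))
      ((Finset.nonempty_iff_ne_empty.2 hS).image _)
    rw [Finset.card_image_of_injective _ hinj] at h2
    simp only [Finset.prod_image (fun a _ b _ h => hinj h)] at h2
    simp only [hG]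
    rw [Int.cast_mul, abs_mul, h1, one_mul]
    exact h2
  have hsplit : ∑ S : Finset (Fin k), G S = G ∅ + ∑ S ∈ Finset.univ.erase ∅, G S :=
    (Finset.add_sum_erase _ _ (Finset.mem_univ _)).symm
  have hBsum : ∑ S : Finset (Fin k), B S = 2 ^ k * ((k + 1) * Real.sqrt p + 2 * k + 3) := by
    have : ∀ S, B S = S.card * (2 * Real.sqrt p + 4) + (Real.sqrt p + 3) := by
      intro S; simp only [hB]; ring
    simp only [this]
    rw [Finset.sum_add_distrib, ← Finset.sum_mul, sum_card_univ]
    simp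
    ring
  rw [hsplit, hG0]
  push_cast
  rw [add_sub_cancel_left, ← hBsum]
  refine (Finset.abs_sum_le_sum_abs _ _).trans ?_
  refine (Finset.sum_le_sum fun S hS => hBG S (Finset.mem_erase.1 hS).1).trans ?_
  refine Finset.sum_le_sum_of_subset_of_nonneg (Finset.erase_subset _ _) fun S _ _ => ?_
  simp only [hB]; positivity

theorem pattern_indicator (p : ℕ) [Fact p.Prime] (k : ℕ)
    (ε : Fin k → ℤ) (hε : ∀ i, ε i = 1 ∨ ε i = -1) (R Z : Finset (ZMod p))
    (hR : ∀ u, u ∈ R ↔ ∀ i : Fin k, u + ((i : ℕ) : ZMod p) ≠ 0 ∧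
        quadraticChar (ZMod p) (u + ((i : ℕ) : ZMod p)) = ε i)
    (hZ : ∀ u, u ∈ Z ↔ ∃ i : Fin k, u + ((i : ℕ) : ZMod p) = 0) (u : ZMod p) :
    |2 ^ k * (if u ∈ R then 1 else 0) -
      ∏ i : Fin k, (1 + ε i * quadraticChar (ZMod p) (u + ((i : ℕ) : ZMod p)))| ≤
      2 ^ k * (if u ∈ Z then (1:ℤ) else 0) := by
  have hfac : ∀ i : Fin k, 0 ≤ 1 + ε i * quadraticChar (ZMod p) (u + ((i : ℕ) : ZMod p)) ∧
      1 + ε i * quadraticChar (ZMod p) (u + ((i : ℕ) : ZMod p)) ≤ 2 := by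
    intro i
    by_cases h : u + ((i : ℕ) : ZMod p) = 0
    · simp [h]
    · rcases quadraticChar_dichotomy h with h' | h' <;> rcases hε i with h'' | h'' <;>
        rw [h', h''] <;> norm_num
  by_cases hz : u ∈ Z
  · have hr : u ∉ R := by
      intro hr
      obtain ⟨i, hi⟩ := (hZ u).1 hz
      exact ((hR u).1 hr i).1 hi
    have h1 : ∏ i : Fin k, (1 + ε i * quadraticChar (ZMod p) (u + ((i : ℕ) : ZMod p))) ≤ 2 ^ k :=
      (Finset.prod_le_prod (fun i _ => (hfac i).1) (fun i _ => (hfac i).2)).trans (by simp)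
    have h0 := Finset.prod_nonneg (s := Finset.univ) fun i _ => (hfac i).1
    simp only [hr, hz, if_true, if_false, mul_zero, zero_sub, abs_neg, mul_one]
    rwa [abs_of_nonneg h0]
  · have hnz : ∀ i : Fin k, u + ((i : ℕ) : ZMod p) ≠ 0 := by
      intro i hi; exact hz ((hZ u).2 ⟨i, hi⟩)
    by_cases hr : u ∈ R
    · have : ∏ i : Fin k, (1 + ε i * quadraticChar (ZMod p) (u + ((i : ℕ) : ZMod p))) = 2 ^ k := by
        rw [Finset.prod_congr rfl (g := fun _ => (2:ℤ))]
        · simp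
        · intro i _
          rw [((hR u).1 hr i).2]
          rcases hε i with h | h <;> rw [h] <;> norm_num
      rw [this]; simp [hr, hz]
    · have : ∏ i : Fin k, (1 + ε i * quadraticChar (ZMod p) (u + ((i : ℕ) : ZMod p))) = 0 := by
        rw [hR] at hr
        push Not at hr
        obtain ⟨i, hi⟩ := hr
        have hi := hi (hnz i)
        refine Finset.prod_eq_zero (Finset.mem_univ i) ?_
        rcases quadraticChar_dichotomy (hnz i) with h' | h' <;> rcases hε i with h'' | h'' <;>
          rw [h', h''] at hi <;> rw [h', h''] <;> omega
      rw [this]; simp [hr, hz]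

/-- Carlitz–Peralta: For an odd prime `p`, `k ≥ 1`, and signs
`ε₀, …, ε_{k−1} ∈ {−1,+1}`, the number `N(k,p)` of `u ∈ F_p` with `u + i ≠ 0` and
`((u+i)|p) = εᵢ` for all `0 ≤ i ≤ k−1` satisfies `N(k,p) = p/2^k + E(k,p)` with
`|E(k,p)| ≤ (k+1)(3 + √p)`. -/
theorem carlitz_peralta
    (p : ℕ) [Fact p.Prime] (hp : Odd p) (k : ℕ) (hk : 1 ≤ k)
    (ε : Fin k → ℤ) (hε : ∀ i, ε i = 1 ∨ ε i = -1) :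
    |({u : ZMod p | ∀ i : Fin k, u + ((i : ℕ) : ZMod p) ≠ 0 ∧
        quadraticChar (ZMod p) (u + ((i : ℕ) : ZMod p)) = ε i}.ncard : ℝ)
      - (p : ℝ) / 2 ^ k| ≤ ((k : ℝ) + 1) * (3 + Real.sqrt p) := by
  classical
  set R : Finset (ZMod p) := Finset.univ.filter fun u => ∀ i : Fin k, u + ((i : ℕ) : ZMod p) ≠ 0 ∧
        quadraticChar (ZMod p) (u + ((i : ℕ) : ZMod p)) = ε i with hR
  have hcard : {u : ZMod p | ∀ i : Fin k, u + ((i : ℕ) : ZMod p) ≠ 0 ∧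
        quadraticChar (ZMod p) (u + ((i : ℕ) : ZMod p)) = ε i}.ncard = R.card := by
    rw [← Set.ncard_coe_finset]
    congr 1
    ext u
    simp [hR]
  rw [hcard]
  have hx0 : 0 ≤ Real.sqrt p := Real.sqrt_nonneg _
  rcases Nat.lt_or_ge k p with hkp | hkp
  · set Z : Finset (ZMod p) := Finset.univ.filter fun u => ∃ i : Fin k, u + ((i : ℕ) : ZMod p) = 0
      with hZ
    have hZc : Z.card ≤ k := by
      have : Z ⊆ Finset.univ.image (fun i : Fin k => -((i : ℕ) : ZMod p)) := by
        intro u hu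
        obtain ⟨i, hi⟩ := (Finset.mem_filter.1 hu).2
        exact Finset.mem_image.2 ⟨i, Finset.mem_univ _, by linear_combination -hi⟩
      refine (Finset.card_le_card this).trans (Finset.card_image_le.trans (by simp))
    have h1 := pattern_charsum p hp k hkp ε hε
    have h2 : |2 ^ k * (R.card : ℤ) - ∑ u : ZMod p, ∏ i : Fin k,
        (1 + ε i * quadraticChar (ZMod p) (u + ((i : ℕ) : ZMod p)))| ≤ 2 ^ k * (k : ℤ) := by
      have e1 : 2 ^ k * (R.card : ℤ) = ∑ u : ZMod p, 2 ^ k * (if u ∈ R then (1:ℤ) else 0) := by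
        rw [← Finset.mul_sum]; simp
      have e2 : 2 ^ k * (Z.card : ℤ) = ∑ u : ZMod p, 2 ^ k * (if u ∈ Z then (1:ℤ) else 0) := by
        rw [← Finset.mul_sum]; simp
      rw [e1, ← Finset.sum_sub_distrib]
      refine (Finset.abs_sum_le_sum_abs _ _).trans ?_
      refine (Finset.sum_le_sum fun u _ => pattern_indicator p k ε hε R Z
        (by intro u; simp [hR]) (by intro u; simp [hZ]) u).trans ?_
      rw [← e2]
      exact mul_le_mul_of_nonneg_left (by exact_mod_cast hZc) (by positivity)
    generalize (∑ u : ZMod p, ∏ i : Fin k,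
        (1 + ε i * quadraticChar (ZMod p) (u + ((i : ℕ) : ZMod p)))) = W at h1 h2
    have h2' : |2 ^ k * (R.card : ℝ) - W| ≤ 2 ^ k * (k : ℝ) := by exact_mod_cast h2
    have h2k : (0:ℝ) < 2 ^ k := by positivity
    have e3 : (R.card : ℝ) - p / 2 ^ k = (2 ^ k * R.card - p) / 2 ^ k := by
      field_simp
    rw [e3, abs_div, abs_of_pos h2k, div_le_iff₀ h2k]
    have h3 := abs_sub_le (2 ^ k * (R.card : ℝ)) W p
    nlinarith
  · have hRp : (R.card : ℝ) ≤ p := by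
      have := R.card_le_univ
      rw [ZMod.card] at this
      exact_mod_cast this
    have hkp' : (p : ℝ) ≤ k := by exact_mod_cast hkp
    have hp2 : (p : ℝ) / 2 ^ k ≤ p := div_le_self (by positivity) (one_le_pow₀ (by norm_num))
    have hp3 : 0 ≤ (p : ℝ) / 2 ^ k := by positivity
    have hR0 : (0:ℝ) ≤ R.card := by positivity
    have hk0 : (0:ℝ) ≤ k := by positivity
    have := mul_nonneg hk0 hx0
    rw [abs_le]
    constructor <;> nlinarith
end

section
/- For every integer n ≥ 1, the set of primes p for which the least quadratic nonresidue modulo p equals the n-th prime p_n has relative density 2^{−n} among all primes; that is, lim_{x→∞} #{odd primes p ≤ x : n_p = p_n}/π(x) = 1/2^n, where π(x) is the number of primes up to x. -/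
/-- The least quadratic nonresidue modulo `p`: the smallest positive integer `n`
that is not a square modulo `p` (equivalently, the Legendre symbol `(n|p) = -1`). -/
noncomputable def leastQuadraticNonresidue (p : ℕ) : ℕ :=
  sInf {n : ℕ | 0 < n ∧ ¬ IsSquare (n : ZMod p)}


open MeasureTheory Filter Topology Set

/-- The Fejer kernel. -/
noncomputable def fejK (v : ℝ) : ℝ := (Real.sinc (v / 2)) ^ 2

lemma fejK_cont : Continuous fejK := by
  unfold fejK
  exact (Real.continuous_sinc.comp (continuous_id.div_const 2)).pow 2

lemma fejK_nonneg (v : ℝ) : 0 ≤ fejK v := sq_nonneg _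

lemma fejK_le_one (v : ℝ) : fejK v ≤ 1 := by
  unfold fejK
  rw [sq_le_one_iff_abs_le_one]
  exact Real.abs_sinc_le_one _

lemma fejK_zero : fejK 0 = 1 := by simp [fejK]

lemma fejK_le (v : ℝ) : fejK v ≤ 5 * (1 + v ^ 2)⁻¹ := by
  have h1 := fejK_le_one v
  have h2 : v ^ 2 * fejK v ≤ 4 := by
    rcases eq_or_ne v 0 with rfl | hv
    · simp
    · unfold fejK
      rw [Real.sinc_of_ne_zero (by simpa using hv)]
      have : v ^ 2 * (Real.sin (v / 2) / (v / 2)) ^ 2 = 4 * Real.sin (v / 2) ^ 2 := by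
        field_simp; ring
      rw [this]
      nlinarith [Real.sin_sq_le_one (v / 2)]
  rw [← div_eq_mul_inv, le_div_iff₀ (by positivity)]
  nlinarith

lemma fejK_integrable : Integrable fejK := by
  refine (integrable_inv_one_add_sq.const_mul 5).mono' fejK_cont.aestronglyMeasurable ?_
  filter_upwards with v
  rw [Real.norm_of_nonneg (fejK_nonneg v)]
  exact fejK_le v

lemma fejK_int_pos : 0 < ∫ v, fejK v := by
  refine integral_pos_of_integrable_nonneg_nonzero (x := 0) fejK_cont fejK_integrable ?_ ?_
  · exact fun v => fejK_nonneg v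
  · rw [fejK_zero]; exact one_ne_zero

lemma tent_half (c : ℂ) (hc : c ≠ 0) :
    ∫ t in (0 : ℝ)..1, ((1 - t : ℝ) : ℂ) * Complex.exp (c * t) =
      Complex.exp c / c ^ 2 - 1 / c - 1 / c ^ 2 := by
  have hd : ∀ t ∈ uIcc (0 : ℝ) 1, HasDerivAt
      (fun t : ℝ => (1 - (t : ℂ)) * Complex.exp (c * t) / c + Complex.exp (c * t) / c ^ 2)
      (((1 - t : ℝ) : ℂ) * Complex.exp (c * t)) t := by
    intro t _
    have h0 : HasDerivAt (fun t : ℝ => (t : ℂ)) 1 t := Complex.ofRealCLM.hasDerivAt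
    have h1 : HasDerivAt (fun t : ℝ => Complex.exp (c * t)) (Complex.exp (c * t) * (c * 1)) t :=
      (h0.const_mul c).cexp
    have h2 := (((h0.const_sub 1).mul h1).div_const c).add (h1.div_const (c ^ 2))
    refine h2.congr_deriv ?_
    push_cast
    field_simp
    ring
  rw [intervalIntegral.integral_eq_sub_of_hasDerivAt hd]
  · simp
    field_simp
    ring
  · apply Continuous.intervalIntegrable
    fun_prop

lemma fejK_fourier (v : ℝ) :
    ∫ t in (-1 : ℝ)..1, ((1 - |t| : ℝ) : ℂ) * Complex.exp (-(Complex.I * v) * t) = fejK v := by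
  have hcont : Continuous fun t : ℝ =>
      ((1 - |t| : ℝ) : ℂ) * Complex.exp (-(Complex.I * v) * t) := by fun_prop
  rw [← intervalIntegral.integral_add_adjacent_intervals (b := 0)
    (hcont.intervalIntegrable _ _) (hcont.intervalIntegrable _ _)]
  have e1 : ∫ t in (0 : ℝ)..1, ((1 - |t| : ℝ) : ℂ) * Complex.exp (-(Complex.I * v) * t) =
      ∫ t in (0 : ℝ)..1, ((1 - t : ℝ) : ℂ) * Complex.exp (-(Complex.I * v) * t) := by
    apply intervalIntegral.integral_congr
    intro t ht
    rw [uIcc_of_le zero_le_one] at ht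
    simp only [abs_of_nonneg ht.1]
  have e2 : ∫ t in (-1 : ℝ)..0, ((1 - |t| : ℝ) : ℂ) * Complex.exp (-(Complex.I * v) * t) =
      ∫ t in (0 : ℝ)..1, ((1 - t : ℝ) : ℂ) * Complex.exp ((Complex.I * v) * t) := by
    have := intervalIntegral.integral_comp_neg (a := 0) (b := 1)
      (fun t : ℝ => ((1 - |t| : ℝ) : ℂ) * Complex.exp (-(Complex.I * v) * t))
    rw [neg_zero] at this
    rw [← this]
    apply intervalIntegral.integral_congr
    intro t ht
    rw [uIcc_of_le zero_le_one] at ht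
    simp only [abs_neg, abs_of_nonneg ht.1]
    congr 2
    push_cast; ring
  rw [e1, e2]
  rcases eq_or_ne v 0 with rfl | hv
  · have : ∫ t in (0 : ℝ)..1, ((1 - t : ℝ) : ℂ) = 1 / 2 := by
      rw [intervalIntegral.integral_ofReal]
      rw [intervalIntegral.integral_sub (by simp) (by simp)]
      simp
      norm_num
    simp only [Complex.ofReal_zero, mul_zero, neg_zero, zero_mul, Complex.exp_zero, mul_one, this,
      fejK_zero]
    norm_num
  · have hc : Complex.I * (v : ℂ) ≠ 0 := by simp [hv]
    rw [tent_half _ hc, tent_half _ (neg_ne_zero.mpr hc)]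
    have hs : (fejK v : ℂ) = (2 - 2 * Complex.cos v) / v ^ 2 := by
      unfold fejK
      rw [Real.sinc_of_ne_zero (by simpa using hv)]
      push_cast
      have h1 := Complex.cos_two_mul ((v : ℂ) / 2)
      have h2 := Complex.sin_sq_add_cos_sq ((v : ℂ) / 2)
      rw [show 2 * ((v : ℂ) / 2) = v by ring] at h1
      have hv' : (v : ℂ) ≠ 0 := by exact_mod_cast hv
      field_simp
      rw [h1]
      linear_combination 2 * h2
    rw [hs, Complex.cos]
    have hv' : (v : ℂ) ≠ 0 := by exact_mod_cast hv
    have h3 : (Complex.I * (v : ℂ)) ^ 2 = - (v : ℂ) ^ 2 := by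
      rw [mul_pow, Complex.I_sq]; ring
    rw [neg_sq, h3, mul_comm Complex.I (v : ℂ)]
    have h4 : (v : ℂ) * Complex.I ≠ 0 := by simp [hv]
    rw [show -(v : ℂ) * Complex.I = -((v : ℂ) * Complex.I) by ring]
    generalize hA : Complex.exp ((v : ℂ) * Complex.I) = A
    generalize hB : Complex.exp (-((v : ℂ) * Complex.I)) = B
    rw [div_neg]
    field_simp
    ring

section Taub

variable {h : ℝ → ℝ} {C : ℝ} {g : ℂ → ℂ}

lemma taub_fubini (hm : Measurable h) (hb : ∀ u, |h u| ≤ C)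
    (hg : ∀ z : ℂ, 0 < z.re → ∫ u in Ioi (0 : ℝ), (h u : ℂ) * Complex.exp (-z * u) = g z)
    (ε : ℝ) (hε : 0 < ε) (y : ℝ) :
    ∫ t in Ioc (-1 : ℝ) 1, ((1 - |t| : ℝ) : ℂ) * Complex.exp (Complex.I * y * t) *
        g (ε + Complex.I * t) =
      ∫ u in Ioi (0 : ℝ), (h u : ℂ) * Complex.exp (-ε * u) * (fejK (u - y) : ℂ) := by
  have hC : 0 ≤ C := (abs_nonneg _).trans (hb 0)
  have key := integral_integral_swap (μ := volume.restrict (Ioc (-1 : ℝ) 1))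
    (ν := volume.restrict (Ioi (0 : ℝ)))
    (f := fun t u => ((1 - |t| : ℝ) : ℂ) * Complex.exp (Complex.I * y * t) *
      ((h u : ℂ) * Complex.exp (-(ε + Complex.I * t) * u))) ?_
  · have hL : ∀ t : ℝ, ∫ u in Ioi (0 : ℝ), ((1 - |t| : ℝ) : ℂ) * Complex.exp (Complex.I * y * t) *
        ((h u : ℂ) * Complex.exp (-(ε + Complex.I * t) * u)) =
        ((1 - |t| : ℝ) : ℂ) * Complex.exp (Complex.I * y * t) * g (ε + Complex.I * t) := by
      intro t
      rw [← hg (ε + Complex.I * t) (by simpa using hε)]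
      rw [← integral_const_mul]
    have hR : ∀ u : ℝ, ∫ t in Ioc (-1 : ℝ) 1,
        ((1 - |t| : ℝ) : ℂ) * Complex.exp (Complex.I * y * t) *
        ((h u : ℂ) * Complex.exp (-(ε + Complex.I * t) * u)) =
        (h u : ℂ) * Complex.exp (-ε * u) * (fejK (u - y) : ℂ) := by
      intro u
      rw [← fejK_fourier, intervalIntegral.integral_of_le (by norm_num), ← integral_const_mul]
      congr 1
      ext t
      have : Complex.exp (Complex.I * y * t) * Complex.exp (-(ε + Complex.I * t) * u) =
          Complex.exp (-ε * u) * Complex.exp (-(Complex.I * (u - y : ℝ)) * t) := by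
        rw [← Complex.exp_add, ← Complex.exp_add]
        congr 1
        push_cast
        ring
      linear_combination (((1 - |t| : ℝ) : ℂ) * (h u : ℂ)) * this
    simp only [hL, hR] at key
    exact key
  · have hbd : Integrable (fun z : ℝ × ℝ => (1 : ℝ) * (C * Real.exp (-ε * z.2)))
        ((volume.restrict (Ioc (-1 : ℝ) 1)).prod (volume.restrict (Ioi (0 : ℝ)))) := by
      apply Integrable.mul_prod (f := fun _ : ℝ => (1 : ℝ)) (g := fun u => C * Real.exp (-ε * u))
      · exact integrable_const _
      · exact (exp_neg_integrableOn_Ioi 0 hε).const_mul C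
    refine hbd.mono' ?_ ?_
    · apply Measurable.aestronglyMeasurable
      unfold Function.uncurry
      fun_prop
    · rw [Measure.prod_restrict]
      refine (ae_restrict_mem (measurableSet_Ioc.prod measurableSet_Ioi)).mono ?_
      rintro ⟨t, u⟩ ⟨ht, hu⟩
      simp only [Function.uncurry]
      rw [norm_mul, norm_mul, norm_mul, Complex.norm_exp, Complex.norm_exp, Complex.norm_real,
        Complex.norm_real]
      have e1 : (Complex.I * y * t).re = 0 := by simp
      have e2 : (-(ε + Complex.I * t) * u).re = -ε * u := by simp
      rw [e1, e2, Real.exp_zero, mul_one]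
      have ht' : |t| ≤ 1 := abs_le.mpr ⟨ht.1.le, ht.2⟩
      have : ‖1 - |t|‖ ≤ 1 := by
        rw [Real.norm_of_nonneg (by linarith)]; linarith [abs_nonneg t]
      have hbu : ‖h u‖ ≤ C := hb u
      gcongr

lemma taub_limit (hm : Measurable h) (hb : ∀ u, |h u| ≤ C)
    (hg : ∀ z : ℂ, 0 < z.re → ∫ u in Ioi (0 : ℝ), (h u : ℂ) * Complex.exp (-z * u) = g z)
    (hgc : ContinuousOn g {z | 0 ≤ z.re}) (y : ℝ) :
    ∫ t in Ioc (-1 : ℝ) 1, ((1 - |t| : ℝ) : ℂ) * Complex.exp (Complex.I * y * t) *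
        g (Complex.I * t) =
      ∫ u in Ioi (0 : ℝ), (h u : ℂ) * (fejK (u - y) : ℂ) := by
  have hC : 0 ≤ C := (abs_nonneg _).trans (hb 0)
  -- a bound for g
  have hcomp : IsCompact ((fun p : ℝ × ℝ => ((p.1 : ℂ) + Complex.I * p.2)) ''
      (Icc (0 : ℝ) 1 ×ˢ Icc (-1 : ℝ) 1)) := by
    apply IsCompact.image (isCompact_Icc.prod isCompact_Icc)
    fun_prop
  obtain ⟨M, hM⟩ := hcomp.exists_bound_of_continuousOn (f := g) (hgc.mono (by
    rintro _ ⟨⟨a, b⟩, ⟨ha, hb⟩, rfl⟩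
    simpa using ha.1))
  have hcontε : ∀ ε : ℝ, 0 ≤ ε → Continuous (fun t : ℝ => g (ε + Complex.I * t)) := by
    intro ε hε
    refine hgc.comp_continuous (by fun_prop) ?_
    intro t
    simpa using hε
  have hev : ∀ᶠ ε : ℝ in 𝓝[>] 0, 0 < ε ∧ ε ≤ 1 := by
    filter_upwards [Ioc_mem_nhdsGT (zero_lt_one' ℝ)] with ε hε using hε
  have l1 : Tendsto (fun ε : ℝ => ∫ t in Ioc (-1 : ℝ) 1, ((1 - |t| : ℝ) : ℂ) *
      Complex.exp (Complex.I * y * t) * g (ε + Complex.I * t)) (𝓝[>] 0)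
      (𝓝 (∫ t in Ioc (-1 : ℝ) 1, ((1 - |t| : ℝ) : ℂ) * Complex.exp (Complex.I * y * t) *
        g (Complex.I * t))) := by
    refine tendsto_integral_filter_of_dominated_convergence (fun _ => M) ?_ ?_
      (integrable_const _) ?_
    · filter_upwards [hev] with ε hε
      apply Continuous.aestronglyMeasurable
      exact Continuous.mul (by fun_prop) (hcontε ε hε.1.le)
    · filter_upwards [hev] with ε hε
      refine (ae_restrict_mem measurableSet_Ioc).mono ?_
      intro t ht
      have ht' : |t| ≤ 1 := abs_le.mpr ⟨ht.1.le, ht.2⟩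
      have hgt : ‖g (ε + Complex.I * t)‖ ≤ M :=
        hM _ ⟨(ε, t), ⟨⟨hε.1.le, hε.2⟩, ⟨ht.1.le, ht.2⟩⟩, rfl⟩
      have e1 : (Complex.I * y * t).re = 0 := by simp
      rw [norm_mul, norm_mul, Complex.norm_exp, Complex.norm_real, e1, Real.exp_zero, mul_one]
      have : ‖1 - |t|‖ ≤ 1 := by
        rw [Real.norm_of_nonneg (by linarith)]; linarith [abs_nonneg t]
      calc _ ≤ 1 * ‖g (ε + Complex.I * t)‖ := by gcongr
        _ ≤ M := by rw [one_mul]; exact hgt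
    · filter_upwards with t
      apply Tendsto.const_mul
      have h1 : ContinuousWithinAt g {z | 0 ≤ z.re} (Complex.I * t) := hgc _ (by simp)
      refine h1.tendsto.comp (tendsto_nhdsWithin_iff.mpr ⟨?_, ?_⟩)
      · have : Continuous (fun ε : ℝ => (ε : ℂ) + Complex.I * t) := by fun_prop
        have h2 := this.tendsto 0
        simp only [Complex.ofReal_zero, zero_add] at h2
        exact h2.mono_left nhdsWithin_le_nhds
      · filter_upwards [hev] with ε hε
        simpa using hε.1.le
  have l2 : Tendsto (fun ε : ℝ => ∫ u in Ioi (0 : ℝ), (h u : ℂ) * Complex.exp (-ε * u) *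
      (fejK (u - y) : ℂ)) (𝓝[>] 0)
      (𝓝 (∫ u in Ioi (0 : ℝ), (h u : ℂ) * (fejK (u - y) : ℂ))) := by
    refine tendsto_integral_filter_of_dominated_convergence (fun u => C * fejK (u - y)) ?_ ?_
      ((fejK_integrable.comp_sub_right y).integrableOn.const_mul C) ?_
    · filter_upwards with ε
      apply Measurable.aestronglyMeasurable
      have := fejK_cont.measurable
      fun_prop
    · filter_upwards [hev] with ε hε
      refine (ae_restrict_mem measurableSet_Ioi).mono ?_
      intro u hu
      have e1 : (-(ε : ℂ) * u).re = -(ε * u) := by simp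
      rw [norm_mul, norm_mul, Complex.norm_exp, Complex.norm_real, Complex.norm_real, e1,
        Real.norm_of_nonneg (fejK_nonneg _)]
      have hbu : ‖h u‖ ≤ C := hb u
      have : Real.exp (-(ε * u)) ≤ 1 := by
        rw [Real.exp_le_one_iff]
        have := mul_pos hε.1 hu
        linarith
      have hf := fejK_nonneg (u - y)
      calc _ ≤ C * 1 * fejK (u - y) := by gcongr
        _ = _ := by ring
    · filter_upwards with u
      have : Continuous (fun ε : ℝ => (h u : ℂ) * Complex.exp (-ε * u) * (fejK (u - y) : ℂ)) := by
        fun_prop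
      have h2 := this.tendsto 0
      simp only [Complex.ofReal_zero, neg_zero, zero_mul, Complex.exp_zero, mul_one] at h2
      exact h2.mono_left nhdsWithin_le_nhds
  refine tendsto_nhds_unique l1 (l2.congr' ?_)
  filter_upwards [hev] with ε hε
  exact (taub_fubini hm hb hg ε hε.1 y).symm

lemma taub_RL (φ : ℝ → ℂ) :
    Tendsto (fun y : ℝ => ∫ t in Ioc (-1 : ℝ) 1, Complex.exp (Complex.I * y * t) * φ t)
      atTop (𝓝 0) := by
  have h1 := Real.tendsto_integral_exp_smul_cocompact ((Ioc (-1 : ℝ) 1).indicator φ)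
  have h2 : Tendsto (fun y : ℝ => -(y / (2 * Real.pi))) atTop (cocompact ℝ) := by
    have : Tendsto (fun y : ℝ => -(y / (2 * Real.pi))) atTop atBot :=
      tendsto_neg_atTop_atBot.comp (tendsto_id.atTop_div_const (by positivity))
    exact this.mono_right atBot_le_cocompact
  refine (h1.comp h2).congr ?_
  intro y
  simp only [Function.comp]
  rw [← integral_indicator measurableSet_Ioc]
  congr 1
  ext t
  by_cases ht : t ∈ Ioc (-1 : ℝ) 1
  · rw [indicator_of_mem ht, indicator_of_mem ht, Circle.smul_def, Real.fourierChar_apply,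
      smul_eq_mul]
    congr 2
    have : (Real.pi : ℂ) ≠ 0 := by exact_mod_cast Real.pi_ne_zero
    push_cast
    field_simp
  · simp [ht]

theorem taub_main (hm : Measurable h) (hb : ∀ u, |h u| ≤ C)
    (hg : ∀ z : ℂ, 0 < z.re → ∫ u in Ioi (0 : ℝ), (h u : ℂ) * Complex.exp (-z * u) = g z)
    (hgc : ContinuousOn g {z | 0 ≤ z.re}) :
    Tendsto (fun y : ℝ => ∫ u in Ioi (0 : ℝ), h u * fejK (u - y)) atTop (𝓝 0) := by
  have h1 := taub_RL (fun t => ((1 - |t| : ℝ) : ℂ) * g (Complex.I * t))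
  have h2 : Tendsto (fun y : ℝ => ∫ u in Ioi (0 : ℝ), ((h u * fejK (u - y) : ℝ) : ℂ))
      atTop (𝓝 0) := by
    refine h1.congr ?_
    intro y
    have := taub_limit hm hb hg hgc y
    push_cast
    rw [← this]
    congr 1
    ext t
    push_cast
    ring
  simp only [integral_complex_ofReal] at h2
  rw [← Complex.ofReal_zero] at h2
  exact tendsto_ofReal_iff.mp h2

theorem taub_scaled (hm : Measurable h) (hb : ∀ u, |h u| ≤ C)
    (hg : ∀ z : ℂ, 0 < z.re → ∫ u in Ioi (0 : ℝ), (h u : ℂ) * Complex.exp (-z * u) = g z)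
    (hgc : ContinuousOn g {z | 0 ≤ z.re}) (l : ℝ) (hl : 0 < l) :
    Tendsto (fun y : ℝ => ∫ u in Ioi (0 : ℝ), h (l⁻¹ * u) * fejK (u - y)) atTop (𝓝 0) := by
  refine taub_main (h := fun u => h (l⁻¹ * u)) (C := C) (g := fun z => l * g (l * z)) (by fun_prop)
    (fun u => hb _) ?_ ?_
  · intro z hz
    have := integral_comp_mul_left_Ioi (fun u : ℝ => (h u : ℂ) * Complex.exp (-(l * z) * u)) 0
      (inv_pos.mpr hl)
    rw [mul_zero, hg (l * z) (by simpa using mul_pos hl hz), inv_inv] at this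
    rw [← Complex.real_smul, ← this]
    congr 1
    ext u
    congr 2
    have : (l : ℂ) ≠ 0 := by exact_mod_cast hl.ne'
    push_cast
    field_simp
  · apply continuousOn_const.mul
    refine hgc.comp (by fun_prop) ?_
    intro z hz
    have hz' : 0 ≤ z.re := hz
    simpa using mul_nonneg hl.le hz'

end Taub


open MeasureTheory Filter Topology Set

lemma fejK_shift_Ioi :
    Tendsto (fun y : ℝ => ∫ u in Ioi (0 : ℝ), fejK (u - y)) atTop (𝓝 (∫ v, fejK v)) := by
  have h1 := (aecover_Ioi (μ := (volume : Measure ℝ))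
    (tendsto_neg_atTop_atBot (G := ℝ))).integral_tendsto_of_countably_generated fejK_integrable
  refine h1.congr ?_
  intro y
  rw [← integral_indicator measurableSet_Ioi, ← integral_indicator measurableSet_Ioi,
    ← integral_sub_right_eq_self _ y]
  congr 1
  ext u
  by_cases hu : 0 < u
  · rw [indicator_of_mem (show u ∈ Ioi (0 : ℝ) from hu), indicator_of_mem]
    simpa using hu
  · rw [indicator_of_notMem (show u ∉ Ioi (0 : ℝ) from hu), indicator_of_notMem]
    simpa using hu

lemma fejK_Icc :
    Tendsto (fun R : ℝ => ∫ u in Icc (-R) R, fejK u) atTop (𝓝 (∫ v, fejK v)) :=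
  (aecover_Icc (μ := (volume : Measure ℝ))
    (tendsto_neg_atTop_atBot (G := ℝ)) tendsto_id).integral_tendsto_of_countably_generated
      fejK_integrable

section

variable {B : ℝ → ℝ} {A C : ℝ} {g : ℂ → ℂ}

lemma B_integrable (hm : Measurable B) (hB0 : ∀ u, 0 ≤ B u) (hBC : ∀ u, B u ≤ C) (l y : ℝ) :
    Integrable (fun v => B (l⁻¹ * (v + y)) * fejK v) := by
  refine (fejK_integrable.const_mul C).mono' ?_ ?_
  · apply Measurable.aestronglyMeasurable
    have := fejK_cont.measurable
    fun_prop
  · filter_upwards with v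
    rw [Real.norm_of_nonneg (mul_nonneg (hB0 _) (fejK_nonneg _))]
    exact mul_le_mul_of_nonneg_right (hBC _) (fejK_nonneg _)

lemma B_smooth (hm : Measurable B) (hB0 : ∀ u, 0 ≤ B u) (hBC : ∀ u, B u ≤ C)
    (hneg : ∀ u < 0, B u = 0)
    (hg : ∀ z : ℂ, 0 < z.re →
      ∫ u in Ioi (0 : ℝ), ((B u - A : ℝ) : ℂ) * Complex.exp (-z * u) = g z)
    (hgc : ContinuousOn g {z | 0 ≤ z.re}) (l : ℝ) (hl : 0 < l) :
    Tendsto (fun y : ℝ => ∫ v, B (l⁻¹ * (v + y)) * fejK v) atTop (𝓝 (A * ∫ v, fejK v)) := by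
  have h1 := taub_scaled (h := fun u => B u - A) (C := C + |A|) (by fun_prop) (by
    intro u
    refine (abs_sub _ _).trans ?_
    rw [abs_of_nonneg (hB0 u)]
    linarith [hBC u]) hg hgc l hl
  have h2 := h1.add (fejK_shift_Ioi.const_mul A)
  rw [zero_add] at h2
  refine h2.congr ?_
  intro y
  have i1 : Integrable (fun u => B (l⁻¹ * u) * fejK (u - y)) := by
    have := (B_integrable hm hB0 hBC l y).comp_sub_right y
    simpa using this
  have i2 : Integrable (fun u => A * fejK (u - y)) := (fejK_integrable.comp_sub_right y).const_mul A
  rw [← integral_const_mul, ← integral_add _ i2.integrableOn]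
  · have e1 : ∀ u, (B (l⁻¹ * u) - A) * fejK (u - y) + A * fejK (u - y) =
        B (l⁻¹ * u) * fejK (u - y) := by intro u; ring
    simp only [e1]
    rw [← integral_Ici_eq_integral_Ioi, setIntegral_eq_integral_of_forall_compl_eq_zero]
    · rw [← integral_sub_right_eq_self (fun v => B (l⁻¹ * (v + y)) * fejK v) y]
      simp
    · intro u hu
      rw [hneg, zero_mul]
      have : u < 0 := by simpa using hu
      exact mul_neg_of_pos_of_neg (inv_pos.mpr hl) this
  · have : (fun u => (B (l⁻¹ * u) - A) * fejK (u - y)) =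
        fun u => B (l⁻¹ * u) * fejK (u - y) - A * fejK (u - y) := by ext u; ring
    rw [this]
    exact (i1.sub i2).integrableOn

theorem B_tendsto (hm : Measurable B) (hB0 : ∀ u, 0 ≤ B u) (hBC : ∀ u, B u ≤ C)
    (hneg : ∀ u < 0, B u = 0) (hmono : ∀ u w, u ≤ w → B u ≤ B w * Real.exp (w - u))
    (hg : ∀ z : ℂ, 0 < z.re →
      ∫ u in Ioi (0 : ℝ), ((B u - A : ℝ) : ℂ) * Complex.exp (-z * u) = g z)
    (hgc : ContinuousOn g {z | 0 ≤ z.re}) :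
    Tendsto B atTop (𝓝 A) := by
  have hI := fejK_int_pos
  set I := ∫ v, fejK v with hIdef
  have hsm := B_smooth hm hB0 hBC hneg hg hgc
  have hR : Tendsto (fun δ : ℝ => ∫ u in Icc (-δ⁻¹) δ⁻¹, fejK u) (𝓝[>] 0) (𝓝 I) :=
    fejK_Icc.comp tendsto_inv_nhdsGT_zero
  have hδ : Tendsto (fun δ : ℝ => δ) (𝓝[>] 0) (𝓝 0) := nhdsWithin_le_nhds
  have hpos : ∀ᶠ δ : ℝ in 𝓝[>] 0, 0 < δ := self_mem_nhdsWithin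
  -- points
  have hrange : ∀ δ : ℝ, 0 < δ → ∀ v ∈ Icc (-δ⁻¹) δ⁻¹, |δ ^ 2 * v| ≤ δ := by
    intro δ hδ v hv
    rw [abs_mul, abs_of_pos (by positivity : 0 < δ ^ 2)]
    have : |v| ≤ δ⁻¹ := abs_le.mpr hv
    calc δ ^ 2 * |v| ≤ δ ^ 2 * δ⁻¹ := by gcongr
      _ = δ := by field_simp
  rw [tendsto_order]
  constructor
  · intro c hc
    have t1 : Tendsto (fun δ : ℝ => c * Real.exp (2 * δ) * I +
        C * (I - ∫ u in Icc (-δ⁻¹) δ⁻¹, fejK u)) (𝓝[>] 0) (𝓝 (c * Real.exp (2 * 0) * I +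
          C * (I - I))) := by
      refine Tendsto.add ?_ ((hR.const_sub I).const_mul C)
      exact (((Real.continuous_exp.tendsto _).comp (hδ.const_mul 2)).const_mul c).mul_const I
    rw [mul_zero, Real.exp_zero, mul_one, sub_self, mul_zero, add_zero] at t1
    obtain ⟨δ, h1, h2⟩ := ((t1.eventually (gt_mem_nhds
      (mul_lt_mul_of_pos_right hc hI))).and hpos).exists
    have h3 := (hsm ((δ ^ 2)⁻¹) (by positivity)).eventually (lt_mem_nhds h1)
    have h4 : Tendsto (fun w : ℝ => (δ ^ 2)⁻¹ * (w - δ)) atTop atTop :=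
      (tendsto_atTop_add_const_right _ (-δ) tendsto_id).const_mul_atTop (by positivity)
    filter_upwards [h4.eventually h3] with w hw
    rw [inv_inv] at hw
    have hup : ∫ v, B (δ ^ 2 * (v + (δ ^ 2)⁻¹ * (w - δ))) * fejK v ≤
        B w * Real.exp (2 * δ) * I + C * (I - ∫ u in Icc (-δ⁻¹) δ⁻¹, fejK u) := by
      have hint := B_integrable hm hB0 hBC (δ ^ 2)⁻¹ ((δ ^ 2)⁻¹ * (w - δ))
      rw [inv_inv] at hint
      rw [← integral_add_compl (measurableSet_Icc (a := -δ⁻¹) (b := δ⁻¹)) hint]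
      have hsplit := integral_add_compl (measurableSet_Icc (a := -δ⁻¹) (b := δ⁻¹)) fejK_integrable
      have hcompl : I - ∫ u in Icc (-δ⁻¹) δ⁻¹, fejK u = ∫ u in (Icc (-δ⁻¹) δ⁻¹)ᶜ, fejK u := by
        rw [hIdef, ← hsplit]; ring
      rw [hcompl]
      apply add_le_add
      · calc _ ≤ ∫ v in Icc (-δ⁻¹) δ⁻¹, B w * Real.exp (2 * δ) * fejK v := by
              apply setIntegral_mono_on hint.integrableOn
                (fejK_integrable.const_mul _).integrableOn measurableSet_Icc
              intro v hv
              have hv' := abs_le.mp (hrange δ h2 v hv)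
              apply mul_le_mul_of_nonneg_right _ (fejK_nonneg v)
              have e : δ ^ 2 * (v + (δ ^ 2)⁻¹ * (w - δ)) = δ ^ 2 * v + w - δ := by
                field_simp; ring
              rw [e]
              refine (hmono _ w (by linarith)).trans ?_
              apply mul_le_mul_of_nonneg_left _ (hB0 w)
              apply Real.exp_le_exp.mpr
              linarith
          _ ≤ _ := by
              rw [integral_const_mul]
              apply mul_le_mul_of_nonneg_left _ (mul_nonneg (hB0 w) (Real.exp_pos _).le)
              exact setIntegral_le_integral fejK_integrable (ae_of_all _ fejK_nonneg)
      · rw [← integral_const_mul]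
        apply setIntegral_mono_on hint.integrableOn
                (fejK_integrable.const_mul _).integrableOn measurableSet_Icc.compl
        intro v _
        exact mul_le_mul_of_nonneg_right (hBC _) (fejK_nonneg v)
    have h5 : c * Real.exp (2 * δ) * I < B w * Real.exp (2 * δ) * I := by linarith
    have h6 := lt_of_mul_lt_mul_right h5 hI.le
    exact lt_of_mul_lt_mul_right h6 (Real.exp_pos _).le
  · intro c hc
    have t1 : Tendsto (fun δ : ℝ => c * (Real.exp (-(2 * δ)) * ∫ u in Icc (-δ⁻¹) δ⁻¹, fejK u))
        (𝓝[>] 0) (𝓝 (c * (Real.exp (-(2 * 0)) * I))) := by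
      refine Tendsto.const_mul c (Tendsto.mul ?_ hR)
      exact (Real.continuous_exp.tendsto _).comp (hδ.const_mul 2).neg
    rw [mul_zero, neg_zero, Real.exp_zero, one_mul] at t1
    obtain ⟨δ, ⟨h1, h2⟩, hRp⟩ := (((t1.eventually (lt_mem_nhds
      (mul_lt_mul_of_pos_right hc hI))).and hpos).and (hR.eventually (lt_mem_nhds hI))).exists
    have h3 := (hsm ((δ ^ 2)⁻¹) (by positivity)).eventually (gt_mem_nhds h1)
    have h4 : Tendsto (fun w : ℝ => (δ ^ 2)⁻¹ * (w + δ)) atTop atTop :=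
      (tendsto_atTop_add_const_right _ δ tendsto_id).const_mul_atTop (by positivity)
    filter_upwards [h4.eventually h3] with w hw
    rw [inv_inv] at hw
    have hlow : B w * (Real.exp (-(2 * δ)) * ∫ u in Icc (-δ⁻¹) δ⁻¹, fejK u) ≤
        ∫ v, B (δ ^ 2 * (v + (δ ^ 2)⁻¹ * (w + δ))) * fejK v := by
      have hint := B_integrable hm hB0 hBC (δ ^ 2)⁻¹ ((δ ^ 2)⁻¹ * (w + δ))
      rw [inv_inv] at hint
      refine le_trans ?_ (setIntegral_le_integral (s := Icc (-δ⁻¹) δ⁻¹) hint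
        (ae_of_all _ fun v => mul_nonneg (hB0 _) (fejK_nonneg v)))
      rw [← mul_assoc, ← integral_const_mul]
      apply setIntegral_mono_on (fejK_integrable.const_mul _).integrableOn
        hint.integrableOn measurableSet_Icc
      intro v hv
      have hv' := abs_le.mp (hrange δ h2 v hv)
      apply mul_le_mul_of_nonneg_right _ (fejK_nonneg v)
      have e : δ ^ 2 * (v + (δ ^ 2)⁻¹ * (w + δ)) = δ ^ 2 * v + w + δ := by
        field_simp; ring
      rw [e]
      have h7 := hmono w (δ ^ 2 * v + w + δ) (by linarith)
      have h8 : B w ≤ B (δ ^ 2 * v + w + δ) * Real.exp (2 * δ) := by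
        refine h7.trans ?_
        apply mul_le_mul_of_nonneg_left _ (hB0 _)
        apply Real.exp_le_exp.mpr
        linarith
      rw [Real.exp_neg, ← div_eq_mul_inv, div_le_iff₀ (Real.exp_pos _)]
      exact h8
    have h9 := lt_of_le_of_lt hlow hw
    exact lt_of_mul_lt_mul_right h9 (mul_pos (Real.exp_pos _) hRp).le

end


open MeasureTheory Filter Topology Set

/-- A version of the Wiener-Ikehara theorem. -/
theorem wiener_ikehara {f : ℕ → ℝ} (hf : ∀ n, 0 ≤ f n) {A C : ℝ}
    (hC : ∀ n : ℕ, ∑ k ∈ Finset.Icc 1 n, f k ≤ C * n) {G : ℂ → ℂ}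
    (hG : ContinuousOn G {s | 1 ≤ s.re})
    (hL : ∀ s : ℂ, 1 < s.re → G s = LSeries (fun n => (f n : ℂ)) s - A / (s - 1)) :
    Tendsto (fun x : ℝ => (∑ k ∈ Finset.Icc 1 ⌊x⌋₊, f k) / x) atTop (𝓝 A) := by
  have hC0 : 0 ≤ C := by
    have := hC 1
    simp at this
    exact (hf 1).trans this
  set S : ℝ → ℝ := fun x => ∑ k ∈ Finset.Icc 1 ⌊x⌋₊, f k with hS
  have hSmono : Monotone S := by
    intro x y hxy
    apply Finset.sum_le_sum_of_subset_of_nonneg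
    · exact Finset.Icc_subset_Icc_right (Nat.floor_le_floor hxy)
    · intro i _ _; exact hf i
  have hS0 : ∀ x, 0 ≤ S x := fun x => Finset.sum_nonneg fun i _ => hf i
  set B : ℝ → ℝ := fun u => S (Real.exp u) * Real.exp (-u) with hB
  have main : Tendsto B atTop (𝓝 A) := by
    refine B_tendsto (C := C) (g := fun z => (G (1 + z) - A) / (1 + z)) ?_ ?_ ?_ ?_ ?_ ?_ ?_
    · have := hSmono.measurable
      fun_prop
    · intro u; exact mul_nonneg (hS0 _) (Real.exp_pos _).le
    · intro u
      rw [hB]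
      simp only
      rw [Real.exp_neg, ← div_eq_mul_inv, div_le_iff₀ (Real.exp_pos _)]
      refine (hC _).trans ?_
      gcongr
      exact Nat.floor_le (Real.exp_pos _).le
    · intro u hu
      have : ⌊Real.exp u⌋₊ = 0 := by
        rw [Nat.floor_eq_zero]
        rw [← Real.exp_zero]
        exact Real.exp_lt_exp.mpr hu
      simp [hB, hS, this]
    · intro u w huw
      simp only [hB]
      have h1 : S (Real.exp u) ≤ S (Real.exp w) := hSmono (Real.exp_le_exp.mpr huw)
      rw [mul_assoc, ← Real.exp_add, show -w + (w - u) = -u by ring]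
      exact mul_le_mul_of_nonneg_right h1 (Real.exp_pos _).le
    · intro z hz
      have hz1 : (1 + z) ≠ 0 := by
        intro h
        have := congrArg Complex.re h
        simp at this
        linarith
      have hz0 : z ≠ 0 := by rintro rfl; simp at hz
      have hO : (fun n : ℕ => ∑ k ∈ Finset.Icc 1 n, f k) =O[atTop] fun n => (n : ℝ) ^ (1 : ℝ) := by
        refine Asymptotics.IsBigO.of_bound C ?_
        filter_upwards with n
        rw [Real.norm_of_nonneg (Finset.sum_nonneg fun i _ => hf i), Real.rpow_one,
          Real.norm_of_nonneg (Nat.cast_nonneg n)]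
        exact hC n
      have h1 := LSeries_eq_mul_integral_of_nonneg f zero_le_one (s := 1 + z) (by simpa using hz)
        hO hf
      have himg : Real.exp '' Ioi (0 : ℝ) = Ioi 1 := by
        ext x
        constructor
        · rintro ⟨u, hu, rfl⟩
          exact Real.one_lt_exp_iff.mpr hu
        · intro hx
          have hx' : (1 : ℝ) < x := hx
          exact ⟨Real.log x, Real.log_pos hx', Real.exp_log (by linarith)⟩
      have h2 := integral_image_eq_integral_abs_deriv_smul (s := Ioi (0 : ℝ)) (f := Real.exp)
        (f' := Real.exp) measurableSet_Ioi (fun x _ => (Real.hasDerivAt_exp x).hasDerivWithinAt)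
        Real.exp_injective.injOn
        (fun t : ℝ => (∑ k ∈ Finset.Icc 1 ⌊t⌋₊, (f k : ℂ)) * (t : ℂ) ^ (-((1 + z) + 1)))
      rw [himg] at h2
      rw [h2] at h1
      have h3 : ∀ u : ℝ, |Real.exp u| • ((∑ k ∈ Finset.Icc 1 ⌊Real.exp u⌋₊, (f k : ℂ)) *
          (Real.exp u : ℂ) ^ (-((1 + z) + 1))) = (B u : ℂ) * Complex.exp (-z * u) := by
        intro u
        simp only [hB, hS]
        rw [abs_of_pos (Real.exp_pos _), Complex.real_smul]
        push_cast
        rw [Complex.cpow_def_of_ne_zero (Complex.exp_ne_zero _)]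
        rw [← Complex.ofReal_exp, ← Complex.ofReal_log (Real.exp_pos _).le, Real.log_exp]
        push_cast
        have : Complex.exp u * Complex.exp (u * -((1 + z) + 1)) =
            Complex.exp (-u) * Complex.exp (-z * u) := by
          rw [← Complex.exp_add, ← Complex.exp_add]
          congr 1; ring
        linear_combination (∑ k ∈ Finset.Icc 1 ⌊Real.exp u⌋₊, (f k : ℂ)) * this
      simp only [h3] at h1
      have hint0 : IntegrableOn (fun u : ℝ => Real.exp (-z.re * u)) (Ioi 0) :=
        exp_neg_integrableOn_Ioi 0 hz
      have hBm : Measurable B := by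
        have := hSmono.measurable
        fun_prop
      have hBC : ∀ u, ‖B u‖ ≤ C := by
        intro u
        rw [Real.norm_of_nonneg (mul_nonneg (hS0 _) (Real.exp_pos _).le)]
        change S (Real.exp u) * Real.exp (-u) ≤ C
        rw [Real.exp_neg, ← div_eq_mul_inv, div_le_iff₀ (Real.exp_pos _)]
        refine (hC _).trans ?_
        gcongr
        exact Nat.floor_le (Real.exp_pos _).le
      have i1 : IntegrableOn (fun u : ℝ => (B u : ℂ) * Complex.exp (-z * u)) (Ioi 0) := by
        refine (hint0.const_mul C).mono' ?_ ?_
        · apply Measurable.aestronglyMeasurable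
          fun_prop
        · filter_upwards with u
          rw [norm_mul, Complex.norm_exp, Complex.norm_real]
          have : (-z * u).re = -z.re * u := by simp
          rw [this]
          exact mul_le_mul_of_nonneg_right (hBC u) (Real.exp_pos _).le
      have i2 : IntegrableOn (fun u : ℝ => (A : ℂ) * Complex.exp (-z * u)) (Ioi 0) := by
        refine (hint0.const_mul |A|).mono' ?_ ?_
        · apply Measurable.aestronglyMeasurable
          fun_prop
        · filter_upwards with u
          rw [norm_mul, Complex.norm_exp, Complex.norm_real]
          have : (-z * u).re = -z.re * u := by simp
          rw [this]
          rfl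
      have h4 : ∫ u in Ioi (0 : ℝ), ((B u - A : ℝ) : ℂ) * Complex.exp (-z * u) =
          (∫ u in Ioi (0 : ℝ), (B u : ℂ) * Complex.exp (-z * u)) -
            ∫ u in Ioi (0 : ℝ), (A : ℂ) * Complex.exp (-z * u) := by
        rw [← integral_sub i1 i2]
        congr 1
        ext u
        push_cast
        ring
      have h5 : ∫ u in Ioi (0 : ℝ), Complex.exp (-z * u) = 1 / z := by
        rw [integral_exp_mul_complex_Ioi (by simpa using hz)]
        simp
      rw [h4, integral_const_mul, h5, hL (1 + z) (by simpa using hz), h1, add_sub_cancel_left]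
      field_simp
      ring
    · refine ContinuousOn.div ((hG.comp (by fun_prop) ?_).sub continuousOn_const) (by fun_prop) ?_
      · intro z hz
        have : 0 ≤ z.re := hz
        simpa using this
      · intro z hz h
        have hz' : 0 ≤ z.re := hz
        have := congrArg Complex.re h
        simp at this
        linarith
  refine (main.comp Real.tendsto_log_atTop).congr' ?_
  filter_upwards [eventually_gt_atTop 0] with x hx
  simp only [Function.comp, hB, hS, Real.exp_neg, Real.exp_log hx, div_eq_mul_inv]

open ArithmeticFunction in
/-- The prime number theorem in arithmetic progressions (von Mangoldt form). -/
theorem pnt_ap {q : ℕ} [NeZero q] {a : ZMod q} (ha : IsUnit a) :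
    Tendsto (fun x : ℝ => (∑ k ∈ Finset.Icc 1 ⌊x⌋₊, vonMangoldt.residueClass a k) / x)
      atTop (𝓝 ((q.totient : ℝ)⁻¹)) := by
  refine wiener_ikehara (C := Real.log 4 + 4) (vonMangoldt.residueClass_nonneg a) ?_
    (vonMangoldt.continuousOn_LFunctionResidueClassAux a) ?_
  · intro n
    refine le_trans ?_ (Chebyshev.psi_le_const_mul_self (Nat.cast_nonneg n))
    rw [Chebyshev.psi, Nat.floor_natCast]
    rw [show Finset.Icc 1 n = Finset.Ioc 0 n by ext; simp [Nat.succ_le_iff]]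
    exact Finset.sum_le_sum fun i _ => vonMangoldt.residueClass_le a i
  · intro s hs
    have := vonMangoldt.eqOn_LFunctionResidueClassAux ha hs
    rw [this]
    push_cast
    rfl


open MeasureTheory Filter Topology Set

open Classical in
/-- number of primes up to `x` satisfying `E` -/
noncomputable def primeCnt (E : ℕ → Prop) (x : ℕ) : ℕ :=
  ((Finset.Icc 1 x).filter (fun p => p.Prime ∧ E p)).card

open Classical in
/-- theta function restricted to `E` -/
noncomputable def thetaE (E : ℕ → Prop) (x : ℕ) : ℝ :=
  ∑ p ∈ (Finset.Icc 1 x).filter (fun p => p.Prime ∧ E p), Real.log p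

open Classical in
/-- psi function restricted to `E` -/
noncomputable def psiE (E : ℕ → Prop) (x : ℕ) : ℝ :=
  ∑ k ∈ Finset.Icc 1 x, if E k then ArithmeticFunction.vonMangoldt k else 0

lemma thetaE_eq (E : ℕ → Prop) (x : ℕ) : thetaE E x = ∑ k ∈ Finset.Icc 1 x,
    open Classical in if E k then (if k.Prime then Real.log k else 0) else 0 := by
  classical
  unfold thetaE
  rw [Finset.sum_filter]
  refine Finset.sum_congr rfl fun k _ => ?_
  by_cases h1 : k.Prime <;> by_cases h2 : E k <;> simp [h1, h2]

lemma psiE_sub_thetaE (E : ℕ → Prop) (x : ℕ) (hx : 1 ≤ x) :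
    |psiE E x - thetaE E x| ≤ 2 * √(x : ℝ) * Real.log x := by
  classical
  refine le_trans ?_ (Chebyshev.abs_psi_sub_theta_le_sqrt_mul_log (x := (x : ℝ))
    (by exact_mod_cast hx))
  have h1 : Chebyshev.psi x - Chebyshev.theta x = ∑ k ∈ Finset.Icc 1 x,
      (ArithmeticFunction.vonMangoldt k - if k.Prime then Real.log k else 0) := by
    rw [Chebyshev.psi, Chebyshev.theta, Nat.floor_natCast, Finset.sum_filter,
      ← Finset.sum_sub_distrib]
    rw [show Finset.Icc 1 x = Finset.Ioc 0 x by ext; simp [Nat.succ_le_iff]]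
  have h2 : psiE E x - thetaE E x = ∑ k ∈ Finset.Icc 1 x,
      if E k then (ArithmeticFunction.vonMangoldt k - if k.Prime then Real.log k else 0)
        else 0 := by
    rw [thetaE_eq, psiE, ← Finset.sum_sub_distrib]
    refine Finset.sum_congr rfl fun k _ => ?_
    by_cases h2 : E k <;> simp [h2]
  have h3 : ∀ k : ℕ, 0 ≤ ArithmeticFunction.vonMangoldt k - if k.Prime then Real.log k else 0 := by
    intro k
    split_ifs with h
    · rw [ArithmeticFunction.vonMangoldt_apply_prime h, sub_self]
    · rw [sub_zero]; exact ArithmeticFunction.vonMangoldt_nonneg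
  have h4 : 0 ≤ psiE E x - thetaE E x := by
    rw [h2]
    refine Finset.sum_nonneg fun k _ => ?_
    by_cases hE : E k
    · simpa [hE] using h3 k
    · simp [hE]
  rw [abs_of_nonneg h4]
  refine le_trans ?_ (le_abs_self _)
  rw [h1, h2]
  refine Finset.sum_le_sum fun k _ => ?_
  by_cases hE : E k
  · simp [hE]
  · simpa [hE] using h3 k

lemma log_div_rpow (η : ℝ) (hη : 0 < η) :
    Tendsto (fun x : ℕ => Real.log x / (x : ℝ) ^ η) atTop (𝓝 0) :=
  ((isLittleO_log_rpow_atTop hη).tendsto_div_nhds_zero).comp tendsto_natCast_atTop_atTop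

lemma thetaE_tendsto (E : ℕ → Prop) (c : ℝ)
    (h : Tendsto (fun x : ℕ => psiE E x / x) atTop (𝓝 c)) :
    Tendsto (fun x : ℕ => thetaE E x / x) atTop (𝓝 c) := by
  have h1 : Tendsto (fun x : ℕ => psiE E x / x - thetaE E x / x) atTop (𝓝 0) := by
    rw [tendsto_zero_iff_abs_tendsto_zero]
    have h2 := (log_div_rpow (1 / 2) (by norm_num)).const_mul 2
    rw [mul_zero] at h2
    refine tendsto_of_tendsto_of_tendsto_of_le_of_le' tendsto_const_nhds h2
      (Eventually.of_forall fun x => abs_nonneg _) ?_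
    filter_upwards [eventually_ge_atTop 1] with x hx
    have hx' : (0 : ℝ) < x := by exact_mod_cast hx
    simp only [Function.comp]
    rw [← sub_div, abs_div, abs_of_pos hx', ← Real.sqrt_eq_rpow]
    have hs : 0 < √(x : ℝ) := Real.sqrt_pos.mpr hx'
    rw [div_le_iff₀ hx']
    refine (psiE_sub_thetaE E x hx).trans (le_of_eq ?_)
    have : (x : ℝ) = √(x : ℝ) * √(x : ℝ) := (Real.mul_self_sqrt hx'.le).symm
    field_simp
    rw [Real.sq_sqrt hx'.le]
    ring
  have := h.sub h1
  simpa using this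

lemma thetaE_le (E : ℕ → Prop) (x : ℕ) : thetaE E x ≤ primeCnt E x * Real.log x := by
  classical
  unfold thetaE primeCnt
  rw [← nsmul_eq_mul]
  apply Finset.sum_le_card_nsmul
  intro p hp
  simp only [Finset.mem_filter, Finset.mem_Icc] at hp
  apply Real.log_le_log
  · exact_mod_cast hp.1.1
  · exact_mod_cast hp.1.2

lemma primeCnt_le (E : ℕ → Prop) (x : ℕ) (hx : 1 ≤ x) (η : ℝ) :
    (1 - η) * Real.log x * primeCnt E x ≤
      thetaE E x + (1 - η) * Real.log x * (x : ℝ) ^ (1 - η) ∨ 1 < η := by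
  classical
  by_cases hη : 1 < η
  · exact Or.inr hη
  left
  push Not at hη
  have hx' : (0 : ℝ) < x := by exact_mod_cast hx
  have hlog : 0 ≤ Real.log x := Real.log_nonneg (by exact_mod_cast hx)
  set Y := (x : ℝ) ^ (1 - η) with hY
  have hY0 : 0 < Y := Real.rpow_pos_of_pos hx' _
  have hlogY : Real.log Y = (1 - η) * Real.log x := Real.log_rpow hx' _
  set F := (Finset.Icc 1 x).filter (fun p => p.Prime ∧ E p) with hF
  have hsplit := Finset.card_filter_add_card_filter_not (s := F) (fun p : ℕ => (p : ℝ) ≤ Y)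
  have h1 : ((F.filter (fun p : ℕ => (p : ℝ) ≤ Y)).card : ℝ) ≤ Y := by
    have : (F.filter (fun p : ℕ => (p : ℝ) ≤ Y)).card ≤ (Finset.Icc 1 ⌊Y⌋₊).card := by
      apply Finset.card_le_card
      intro p hp
      simp only [hF, Finset.mem_filter, Finset.mem_Icc] at hp ⊢
      exact ⟨hp.1.1.1, Nat.le_floor hp.2⟩
    rw [Nat.card_Icc, Nat.add_sub_cancel] at this
    calc _ ≤ ((⌊Y⌋₊ : ℕ) : ℝ) := by exact_mod_cast this
      _ ≤ Y := Nat.floor_le hY0.le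
  have h2 : ((F.filter (fun p : ℕ => ¬ (p : ℝ) ≤ Y)).card : ℝ) * Real.log Y ≤ thetaE E x := by
    rw [← nsmul_eq_mul]
    refine (Finset.card_nsmul_le_sum _ (fun p : ℕ => Real.log p) _ ?_).trans ?_
    · intro p hp
      simp only [Finset.mem_filter, not_le] at hp
      exact Real.log_le_log hY0 hp.2.le
    · unfold thetaE
      apply Finset.sum_le_sum_of_subset_of_nonneg
      · exact Finset.filter_subset _ _
      · intro p _ _
        exact Real.log_natCast_nonneg p
  have h3 : (primeCnt E x : ℝ) = (F.filter (fun p : ℕ => (p : ℝ) ≤ Y)).card +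
      (F.filter (fun p : ℕ => ¬ (p : ℝ) ≤ Y)).card := by
    unfold primeCnt
    exact_mod_cast hsplit.symm
  rw [h3, ← hlogY, mul_add]
  have hl0 : 0 ≤ Real.log Y := by rw [hlogY]; exact mul_nonneg (by linarith) hlog
  have := mul_le_mul_of_nonneg_left h1 hl0
  linarith [mul_comm (Real.log Y) ((F.filter (fun p : ℕ => ¬ (p : ℝ) ≤ Y)).card : ℝ)]

theorem primeCnt_tendsto (E : ℕ → Prop) (c : ℝ)
    (h : Tendsto (fun x : ℕ => psiE E x / x) atTop (𝓝 c)) :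
    Tendsto (fun x : ℕ => primeCnt E x * Real.log x / x) atTop (𝓝 c) := by
  have hθ := thetaE_tendsto E c h
  rw [tendsto_order]
  constructor
  · intro a ha
    filter_upwards [hθ.eventually (lt_mem_nhds ha)] with x hx
    refine hx.trans_le ?_
    gcongr
    exact thetaE_le E x
  · intro a ha
    have t1 : Tendsto (fun η : ℝ => c / (1 - η)) (𝓝[>] 0) (𝓝 (c / (1 - 0))) := by
      refine Tendsto.div tendsto_const_nhds ?_ (by norm_num)
      have t0 : Tendsto (fun η : ℝ => η) (𝓝[>] 0) (𝓝 0) := nhdsWithin_le_nhds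
      exact t0.const_sub 1
    rw [sub_zero, div_one] at t1
    obtain ⟨η, h1, h2⟩ := ((t1.eventually (gt_mem_nhds ha)).and
      (Ioo_mem_nhdsGT (zero_lt_one' ℝ))).exists
    have t2 : Tendsto (fun x : ℕ => thetaE E x / x / (1 - η) + Real.log x / (x : ℝ) ^ η) atTop
        (𝓝 (c / (1 - η) + 0)) := (hθ.div_const _).add (log_div_rpow η h2.1)
    rw [add_zero] at t2
    filter_upwards [t2.eventually (gt_mem_nhds h1), eventually_ge_atTop 1] with x hx hx1
    refine lt_of_le_of_lt ?_ hx
    have hx' : (0 : ℝ) < x := by exact_mod_cast hx1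
    have h3 := (primeCnt_le E x hx1 η).resolve_right (by linarith [h2.2])
    have h4 : 0 < 1 - η := by linarith [h2.2]
    rw [Real.rpow_sub hx', Real.rpow_one] at h3
    have h5 : 0 < (x : ℝ) ^ η := Real.rpow_pos_of_pos hx' _
    have h6 : thetaE E x / x / (1 - η) + Real.log x / (x : ℝ) ^ η =
        (thetaE E x + (1 - η) * Real.log x * (x / (x : ℝ) ^ η)) / ((1 - η) * x) := by
      field_simp
    rw [h6, div_le_div_iff₀ hx' (by positivity)]
    nlinarith [mul_le_mul_of_nonneg_right h3 hx'.le]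

open ArithmeticFunction in
lemma psiE_residue {q : ℕ} [NeZero q] (T : Finset (ZMod q)) (hT : ∀ a ∈ T, IsUnit a) :
    Tendsto (fun x : ℕ => psiE (fun n => (n : ZMod q) ∈ T) x / x) atTop
      (𝓝 (T.card * (q.totient : ℝ)⁻¹)) := by
  classical
  have h1 : Tendsto (fun x : ℕ => ∑ a ∈ T, (∑ k ∈ Finset.Icc 1 x,
      vonMangoldt.residueClass a k) / (x : ℝ)) atTop (𝓝 (∑ a ∈ T, (q.totient : ℝ)⁻¹)) := by
    refine tendsto_finsetSum _ fun a ha => ?_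
    have := (pnt_ap (hT a ha)).comp tendsto_natCast_atTop_atTop
    refine this.congr fun x => ?_
    simp
  rw [Finset.sum_const, nsmul_eq_mul] at h1
  refine h1.congr fun x => ?_
  rw [← Finset.sum_div, Finset.sum_comm]
  congr 1
  unfold psiE
  refine Finset.sum_congr rfl fun k _ => ?_
  simp only [vonMangoldt.residueClass, Set.indicator_apply, Set.mem_ofPred_eq]
  rw [Finset.sum_ite_eq]
  congr

theorem prime_density {q : ℕ} [NeZero q] (T : Finset (ZMod q)) (hT : ∀ a ∈ T, IsUnit a) :
    Tendsto (fun x : ℕ => (primeCnt (fun n => (n : ZMod q) ∈ T) x : ℝ) / Nat.primeCounting x) atTop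
      (𝓝 (T.card * (q.totient : ℝ)⁻¹)) := by
  have h1 := primeCnt_tendsto _ _ (psiE_residue T hT)
  have h2 := primeCnt_tendsto _ _ (psiE_residue (q := 1) Finset.univ (by
    intro a _
    exact isUnit_of_subsingleton a))
  have h3 : ∀ x, primeCnt (fun n => (n : ZMod 1) ∈ (Finset.univ : Finset (ZMod 1))) x =
      Nat.primeCounting x := by
    intro x
    classical
    unfold primeCnt
    rw [Nat.primeCounting, Nat.primeCounting', Nat.count_eq_card_filter_range]
    congr 1
    ext p
    simp only [Finset.mem_filter, Finset.mem_Icc, Finset.mem_univ, and_true, Finset.mem_range]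
    constructor
    · rintro ⟨h, hp⟩; exact ⟨by omega, hp⟩
    · rintro ⟨h, hp⟩; exact ⟨⟨hp.one_lt.le, by omega⟩, hp⟩
  simp only [h3] at h2
  have h4 : ((Finset.univ : Finset (ZMod 1)).card : ℝ) * ((1 : ℕ).totient : ℝ)⁻¹ = 1 := by
    simp
  rw [h4] at h2
  have h5 := h1.div h2 one_ne_zero
  rw [div_one] at h5
  refine h5.congr' ?_
  filter_upwards [eventually_ge_atTop 2] with x hx
  have hx' : (0 : ℝ) < x := by exact_mod_cast (by omega : 0 < x)
  have hl : 0 < Real.log x := Real.log_pos (by exact_mod_cast (by omega : 1 < x))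
  have hpi : 0 < (Nat.primeCounting x : ℝ) := by
    have : 0 < Nat.primeCounting x := by
      have hm := Nat.monotone_primeCounting hx
      have h2 : Nat.primeCounting 2 = 1 := by decide
      omega
    exact_mod_cast this
  simp only [Pi.div_apply]
  field_simp

open MeasureTheory Filter Topology Set

/-- the `i`-th prime (starting at 0) -/
noncomputable def rpr (i : ℕ) : ℕ := Nat.nth Nat.Prime i

lemma rpr_prime (i : ℕ) : (rpr i).Prime := Nat.prime_nth_prime i

lemma rpr_strictMono : StrictMono rpr := Nat.nth_strictMono Nat.infinite_setOf_prime

lemma rpr_zero : rpr 0 = 2 := Nat.nth_prime_zero_eq_two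

lemma rpr_odd {j : ℕ} (hj : j ≠ 0) : Odd (rpr j) := by
  apply (rpr_prime j).odd_of_ne_two
  rw [← rpr_zero]
  exact fun h => hj (rpr_strictMono.injective h)

/-- the modulus -/
noncomputable def modq (n : ℕ) : ℕ := 4 * ∏ i ∈ Finset.range n, rpr i

lemma modq_ne (n : ℕ) : modq n ≠ 0 := by
  unfold modq
  refine mul_ne_zero (by norm_num) (Finset.prod_ne_zero_iff.mpr fun i _ => (rpr_prime i).ne_zero)

instance (n : ℕ) : NeZero (modq n) := ⟨modq_ne n⟩

lemma dvd_modq {n i : ℕ} (hi : i < n) : 4 * rpr i ∣ modq n :=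
  mul_dvd_mul_left 4 (Finset.dvd_prod_of_mem _ (Finset.mem_range.mpr hi))

lemma two_dvd_modq (n : ℕ) : 2 ∣ modq n := (by norm_num : 2 ∣ 4).trans (Dvd.intro _ rfl)

/-- the `i`-th quadratic character -/
noncomputable def chi (n i : ℕ) (a : ZMod (modq n)) : ℤ := jacobiSym (rpr i) a.val

lemma chi_nat {n i b : ℕ} (hi : i < n) (hb : Odd b) :
    chi n i (b : ZMod (modq n)) = jacobiSym (rpr i) b := by
  unfold chi
  rw [ZMod.val_natCast]
  have hodd : Odd (b % modq n) := by
    rw [Nat.odd_iff] at hb ⊢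
    rw [Nat.mod_mod_of_dvd _ (two_dvd_modq n), hb]
  rw [jacobiSym.mod_right _ hodd, jacobiSym.mod_right _ hb, Int.natAbs_natCast,
    Nat.mod_mod_of_dvd _ (dvd_modq hi)]

lemma unit_coprime {n : ℕ} (a : (ZMod (modq n))ˣ) : (a : ZMod (modq n)).val.Coprime (modq n) :=
  ZMod.val_coe_unit_coprime a

lemma unit_odd {n : ℕ} (a : (ZMod (modq n))ˣ) : Odd (a : ZMod (modq n)).val := by
  rw [← Nat.coprime_two_right]
  exact (unit_coprime a).coprime_dvd_right (two_dvd_modq n)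

lemma chi_mul {n i : ℕ} (hi : i < n) (a b : (ZMod (modq n))ˣ) :
    chi n i ((a * b : (ZMod (modq n))ˣ) : ZMod (modq n)) = chi n i a * chi n i b := by
  have h1 : ((a * b : (ZMod (modq n))ˣ) : ZMod (modq n)) =
      (((a : ZMod (modq n)).val * (b : ZMod (modq n)).val : ℕ) : ZMod (modq n)) := by
    push_cast
    rw [ZMod.natCast_zmod_val, ZMod.natCast_zmod_val]
  rw [h1, chi_nat hi ((unit_odd a).mul (unit_odd b))]
  unfold chi
  exact jacobiSym.mul_right' _ (unit_odd a).pos.ne' (unit_odd b).pos.ne'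

lemma chi_pm {n i : ℕ} (hi : i < n) (a : (ZMod (modq n))ˣ) :
    chi n i a = 1 ∨ chi n i a = -1 := by
  apply jacobiSym.eq_one_or_neg_one
  rw [Int.gcd_natCast_natCast]
  exact ((unit_coprime a).coprime_dvd_right ((Dvd.intro_left 4 rfl).trans (dvd_modq hi))).symm

lemma exists_sep_aux (n j : ℕ) : ∃ m : ℕ, m % 4 = 1 ∧ jacobiSym (rpr j) m = -1 ∧
    ∀ i < n, i ≠ j → jacobiSym (rpr i) m = 1 := by
  have hcop : ∀ i, i ≠ j → Nat.Coprime (rpr j) (rpr i) := by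
    intro i hij
    rw [Nat.coprime_primes (rpr_prime j) (rpr_prime i)]
    exact fun h => hij (rpr_strictMono.injective h).symm
  have fin : ∀ m : ℕ, m % 4 = 1 → (∀ i < n, i ≠ j → m % (4 * rpr i) = 1) →
      ∀ i < n, i ≠ j → jacobiSym (rpr i) m = 1 := by
    intro m hm h i hi hij
    have hodd : Odd m := by rw [Nat.odd_iff]; omega
    rw [jacobiSym.mod_right _ hodd, Int.natAbs_natCast, h i hi hij, jacobiSym.one_right]
  have one_mod : ∀ m i, m ≡ 1 [MOD 4 * rpr i] → m % (4 * rpr i) = 1 := by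
    intro m i h
    rw [h, Nat.mod_eq_of_lt]
    have := (rpr_prime i).pos
    omega
  rcases Nat.eq_zero_or_pos j with rfl | hj
  · have hc : Nat.Coprime 8 (∏ i ∈ (Finset.range n).erase 0, rpr i) := by
      apply Nat.Coprime.prod_right
      intro i hi
      have := hcop i (Finset.ne_of_mem_erase hi)
      rw [rpr_zero] at this
      exact Nat.Coprime.pow_left 3 this
    obtain ⟨m, h1, h2⟩ := Nat.chineseRemainder hc 5 1
    have h8 : m % 8 = 5 := h1
    have h4 : m % 4 = 1 := by omega
    refine ⟨m, h4, ?_, fin m h4 ?_⟩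
    · have hodd : Odd m := by rw [Nat.odd_iff]; omega
      rw [rpr_zero, jacobiSym.mod_right _ hodd]
      norm_num [h8]
    · intro i hi hij
      apply one_mod
      have h5 : m ≡ 1 [MOD rpr i] := h2.of_dvd
        (Finset.dvd_prod_of_mem _ (Finset.mem_erase.mpr ⟨hij, Finset.mem_range.mpr hi⟩))
      have h6 : m ≡ 1 [MOD 4] := h4
      refine (Nat.modEq_and_modEq_iff_modEq_mul ?_).mp ⟨h6, h5⟩
      have := hcop i hij
      rw [rpr_zero] at this
      exact Nat.Coprime.pow_left 2 this
  · have hoddj := rpr_odd hj.ne'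
    haveI : Fact (rpr j).Prime := ⟨rpr_prime j⟩
    have hc : Nat.Coprime (rpr j) (4 * ∏ i ∈ (Finset.range n).erase j, rpr i) := by
      apply Nat.Coprime.mul_right
      · exact Nat.Coprime.pow_right 2 (Nat.coprime_two_right.mpr hoddj)
      · apply Nat.Coprime.prod_right
        intro i hi
        exact hcop i (Finset.ne_of_mem_erase hi)
    obtain ⟨a, ha⟩ := FiniteField.exists_nonsquare (F := ZMod (rpr j)) (by
      rw [ZMod.ringChar_zmod_n]
      intro h
      rw [h] at hoddj
      exact absurd hoddj (by decide))
    obtain ⟨m, h1, h2⟩ := Nat.chineseRemainder hc a.val 1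
    have h4 : m % 4 = 1 := h2.of_dvd (Dvd.intro _ rfl)
    refine ⟨m, h4, ?_, fin m h4 ?_⟩
    · rw [← jacobiSym.quadratic_reciprocity_one_mod_four h4 hoddj, ← jacobiSym.legendreSym.to_jacobiSym,
        legendreSym.eq_neg_one_iff]
      have : ((m : ℤ) : ZMod (rpr j)) = a := by
        have h5 := (ZMod.natCast_eq_natCast_iff _ _ _).mpr h1
        rw [ZMod.natCast_zmod_val] at h5
        exact_mod_cast h5
      rwa [this]
    · intro i hi hij
      apply one_mod
      exact h2.of_dvd (mul_dvd_mul_left 4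
        (Finset.dvd_prod_of_mem _ (Finset.mem_erase.mpr ⟨hij, Finset.mem_range.mpr hi⟩)))

lemma exists_sep {n j : ℕ} (hj : j < n) : ∃ u : (ZMod (modq n))ˣ, chi n j u = -1 ∧
    ∀ i < n, i ≠ j → chi n i u = 1 := by
  obtain ⟨m, h4, h1, h2⟩ := exists_sep_aux n j
  have hodd : Odd m := by rw [Nat.odd_iff]; omega
  have hc : m.Coprime (modq n) := by
    unfold modq
    apply Nat.Coprime.mul_right
    · exact Nat.Coprime.pow_right 2 (Nat.coprime_two_right.mpr hodd)
    · apply Nat.Coprime.prod_right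
      intro i hi
      have hne : jacobiSym (rpr i) m ≠ 0 := by
        by_cases hij : i = j
        · rw [hij, h1]; norm_num
        · rw [h2 i (Finset.mem_range.mp hi) hij]; norm_num
      haveI : NeZero m := ⟨hodd.pos.ne'⟩
      have h3 : Int.gcd (rpr i : ℤ) m = 1 := by
        by_contra h
        exact hne (jacobiSym.eq_zero_iff_not_coprime.mpr h)
      rw [Int.gcd_natCast_natCast] at h3
      exact Nat.Coprime.symm h3
  refine ⟨ZMod.unitOfCoprime m hc, ?_, ?_⟩
  · rw [ZMod.coe_unitOfCoprime, chi_nat hj hodd, h1]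
  · intro i hi hij
    rw [ZMod.coe_unitOfCoprime, chi_nat hi hodd, h2 i hi hij]

open Classical in
/-- units on which the first `k` characters are trivial -/
noncomputable def Uset (n k : ℕ) : Finset (ZMod (modq n))ˣ :=
  Finset.univ.filter fun a => ∀ i < k, chi n i a = 1

open Classical in
/-- units on which the first `k` characters are trivial and the next is not -/
noncomputable def Vset (n k : ℕ) : Finset (ZMod (modq n))ˣ :=
  Finset.univ.filter fun a => (∀ i < k, chi n i a = 1) ∧ chi n k a = -1

lemma card_V_eq {n k : ℕ} (hk : k < n) : (Vset n k).card = (Uset n (k + 1)).card := by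
  classical
  obtain ⟨u, h1, h2⟩ := exists_sep hk
  apply Finset.card_bij' (fun a _ => a * u) (fun a _ => a * u⁻¹)
  · intro a ha
    simp only [Vset, Uset, Finset.mem_filter, Finset.mem_univ, true_and] at ha ⊢
    intro i hi
    rw [chi_mul (by omega)]
    rcases eq_or_ne i k with rfl | hik
    · rw [ha.2, h1]; norm_num
    · rw [ha.1 i (by omega), h2 i (by omega) hik, one_mul]
  · intro a ha
    simp only [Vset, Uset, Finset.mem_filter, Finset.mem_univ, true_and] at ha ⊢
    have key : ∀ i < n, chi n i (a * u⁻¹ : (ZMod (modq n))ˣ) * chi n i u = chi n i a := by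
      intro i hi
      rw [← chi_mul hi, inv_mul_cancel_right]
    constructor
    · intro i hi
      have := key i (by omega)
      rw [h2 i (by omega) (by omega), mul_one] at this
      rw [this, ha i (by omega)]
    · have := key k hk
      rw [h1, ha k (by omega)] at this
      linarith
  · intro a _; simp
  · intro a _; simp

lemma card_U {n k : ℕ} (hk : k ≤ n) : (Uset n k).card * 2 ^ k = (modq n).totient := by
  classical
  induction k with
  | zero =>
    have : Uset n 0 = Finset.univ := by
      unfold Uset
      simp
    rw [this, Finset.card_univ, ZMod.card_units_eq_totient]
    simp
  | succ k ih =>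
    rw [← ih (by omega)]
    have h1 : Uset n k = Uset n (k + 1) ∪ Vset n k := by
      ext a
      simp only [Vset, Uset, Finset.mem_filter, Finset.mem_univ, true_and, Finset.mem_union]
      constructor
      · intro h
        rcases chi_pm (show k < n by omega) a with h3 | h3
        · left
          intro i hi
          rcases eq_or_ne i k with rfl | hik
          · exact h3
          · exact h i (by omega)
        · exact Or.inr ⟨h, h3⟩
      · rintro (h | h)
        · exact fun i hi => h i (by omega)
        · exact h.1
    have h2 : Disjoint (Uset n (k + 1)) (Vset n k) := by
      rw [Finset.disjoint_left]
      intro a ha hb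
      simp only [Vset, Uset, Finset.mem_filter, Finset.mem_univ, true_and] at ha hb
      have := ha k (by omega)
      rw [hb.2] at this
      norm_num at this
    rw [h1, Finset.card_union_of_disjoint h2, card_V_eq (by omega)]
    ring

lemma isSquare_of_primes {p : ℕ} (m : ℕ) :
    m ≠ 0 → (∀ l : ℕ, l.Prime → l ∣ m → IsSquare (l : ZMod p)) → IsSquare (m : ZMod p) := by
  induction m using Nat.recOnMul with
  | zero => intro h; exact absurd rfl h
  | one => intro _ _; simp
  | prime l hl => intro _ h; exact h l hl dvd_rfl
  | mul a b iha ihb =>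
    intro h0 h
    push_cast
    exact (iha (left_ne_zero_of_mul h0) fun l hl hd => h l hl (hd.mul_right b)).mul
      (ihb (right_ne_zero_of_mul h0) fun l hl hd => h l hl (hd.mul_left a))

lemma least_iff {N p : ℕ} (hp : p.Prime) (hc : p.Coprime (modq (N + 1))) :
    leastQuadraticNonresidue p = rpr N ↔
      (∀ i < N, jacobiSym (rpr i) p = 1) ∧ jacobiSym (rpr N) p = -1 := by
  haveI : Fact p.Prime := ⟨hp⟩
  have hne : ∀ i < N + 1, ((rpr i : ℤ) : ZMod p) ≠ 0 := by
    intro i hi h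
    have h1 : ((rpr i : ℕ) : ZMod p) = 0 := by exact_mod_cast h
    rw [ZMod.natCast_eq_zero_iff] at h1
    have h2 : p ∣ modq (N + 1) := h1.trans ((Dvd.intro_left 4 rfl).trans (dvd_modq hi))
    exact (hp.coprime_iff_not_dvd.mp hc) h2
  have h1 : ∀ i < N + 1, (IsSquare (rpr i : ZMod p) ↔ jacobiSym (rpr i) p = 1) := by
    intro i hi
    rw [← jacobiSym.legendreSym.to_jacobiSym, legendreSym.eq_one_iff p (hne i hi)]
    norm_cast
  have h2 : ∀ i < N + 1, (¬ IsSquare (rpr i : ZMod p) ↔ jacobiSym (rpr i) p = -1) := by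
    intro i hi
    rw [← jacobiSym.legendreSym.to_jacobiSym, legendreSym.eq_neg_one_iff p]
    norm_cast
  unfold leastQuadraticNonresidue
  constructor
  · intro h
    have hpos : 0 < sInf {n : ℕ | 0 < n ∧ ¬ IsSquare (n : ZMod p)} := by
      rw [h]; exact (rpr_prime N).pos
    have hmem := Nat.sInf_mem (Nat.nonempty_of_pos_sInf hpos)
    constructor
    · intro i hi
      rw [← h1 i (by omega)]
      by_contra hcon
      have hlt : rpr i < sInf {n : ℕ | 0 < n ∧ ¬ IsSquare (n : ZMod p)} := by
        rw [h]; exact rpr_strictMono hi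
      exact Nat.notMem_of_lt_sInf hlt ⟨(rpr_prime i).pos, hcon⟩
    · rw [h] at hmem
      exact (h2 N (by omega)).mp hmem.2
  · rintro ⟨ha, hb⟩
    have hmem : rpr N ∈ {n : ℕ | 0 < n ∧ ¬ IsSquare (n : ZMod p)} :=
      ⟨(rpr_prime N).pos, (h2 N (by omega)).mpr hb⟩
    apply le_antisymm (Nat.sInf_le hmem)
    apply le_csInf ⟨_, hmem⟩
    rintro m ⟨hm0, hm⟩
    by_contra hlt
    push Not at hlt
    apply hm
    apply isSquare_of_primes m hm0.ne'
    intro l hl hd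
    have hle : l < rpr N := (Nat.le_of_dvd hm0 hd).trans_lt hlt
    have heq : rpr (Nat.count Nat.Prime l) = l := Nat.nth_count hl
    have hi : Nat.count Nat.Prime l < N := by
      rw [← rpr_strictMono.lt_iff_lt, heq]
      exact hle
    have := (h1 _ (by omega)).mpr (ha _ hi)
    rwa [heq] at this

/-- the residue classes of interest -/
noncomputable def Tset (N : ℕ) : Finset (ZMod (modq (N + 1))) :=
  (Vset (N + 1) N).map ⟨Units.val, Units.val_injective⟩

lemma card_T (N : ℕ) : ((Tset N).card : ℝ) * ((modq (N + 1)).totient : ℝ)⁻¹ = 1 / 2 ^ (N + 1) := by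
  unfold Tset
  rw [Finset.card_map, card_V_eq (by omega), ← card_U (n := N + 1) le_rfl]
  have h : 0 < (Uset (N + 1) (N + 1)).card := by
    apply Nat.pos_of_ne_zero
    intro h0
    have h1 := card_U (n := N + 1) le_rfl
    rw [h0, zero_mul] at h1
    exact (Nat.totient_pos.mpr (Nat.pos_of_ne_zero (modq_ne (N + 1)))).ne h1
  have h' : ((Uset (N + 1) (N + 1)).card : ℝ) ≠ 0 := by exact_mod_cast h.ne'
  push_cast
  field_simp

lemma mem_T_iff {N p : ℕ} (hp : p.Prime) (hc : p.Coprime (modq (N + 1))) :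
    (p : ZMod (modq (N + 1))) ∈ Tset N ↔ leastQuadraticNonresidue p = rpr N := by
  classical
  have hodd : Odd p := by
    rw [← Nat.coprime_two_right]
    exact hc.coprime_dvd_right (two_dvd_modq _)
  rw [least_iff hp hc]
  have h1 : (p : ZMod (modq (N + 1))) ∈ Tset N ↔ ZMod.unitOfCoprime p hc ∈ Vset (N + 1) N := by
    unfold Tset
    rw [Finset.mem_map]
    constructor
    · rintro ⟨a, ha, hap⟩
      have : a = ZMod.unitOfCoprime p hc := by
        apply Units.ext
        rw [ZMod.coe_unitOfCoprime]
        exact hap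
      rwa [← this]
    · intro h
      exact ⟨_, h, ZMod.coe_unitOfCoprime p hc⟩
  rw [h1]
  simp only [Vset, Finset.mem_filter, Finset.mem_univ, true_and, ZMod.coe_unitOfCoprime]
  rw [chi_nat (by omega) hodd]
  refine and_congr_left fun _ => forall₂_congr fun i hi => ?_
  rw [chi_nat (by omega) hodd]

lemma count_close (N x : ℕ) :
    |(({p : ℕ | p.Prime ∧ Odd p ∧ p ≤ x ∧ leastQuadraticNonresidue p = rpr N}.ncard : ℝ)) -
      primeCnt (fun n => (n : ZMod (modq (N + 1))) ∈ Tset N) x| ≤ modq (N + 1) := by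
  classical
  set q := modq (N + 1) with hq
  set X := (Finset.Icc 1 x).filter
    (fun p => p.Prime ∧ Odd p ∧ leastQuadraticNonresidue p = rpr N) with hX
  set Y := (Finset.Icc 1 x).filter (fun p : ℕ => p.Prime ∧ ((p : ℕ) : ZMod q) ∈ Tset N) with hY
  have e1 : {p : ℕ | p.Prime ∧ Odd p ∧ p ≤ x ∧ leastQuadraticNonresidue p = rpr N} = (X : Set ℕ) := by
    ext p
    simp only [hX, Set.mem_setOf_eq, Finset.coe_filter, Finset.mem_Icc]
    constructor
    · rintro ⟨h1, h2, h3, h4⟩; exact ⟨⟨h1.one_lt.le, h3⟩, h1, h2, h4⟩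
    · rintro ⟨⟨_, h3⟩, h1, h2, h4⟩; exact ⟨h1, h2, h3, h4⟩
  have e2 : primeCnt (fun n => (n : ZMod q) ∈ Tset N) x = Y.card := by
    unfold primeCnt
    congr!
  rw [e1, Set.ncard_coe_finset, e2]
  have hD : (Nat.divisors q).card ≤ q := Nat.card_divisors_le_self q
  have hcop : ∀ p : ℕ, p.Prime → p ∉ Nat.divisors q → p.Coprime q := by
    intro p hp h
    rw [hp.coprime_iff_not_dvd]
    intro hd
    exact h (Nat.mem_divisors.mpr ⟨hd, modq_ne _⟩)
  have h1 : X ⊆ Y ∪ Nat.divisors q := by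
    intro p hp
    simp only [hX, hY, Finset.mem_filter, Finset.mem_union] at hp ⊢
    by_cases hd : p ∈ Nat.divisors q
    · exact Or.inr hd
    · left
      exact ⟨hp.1, hp.2.1, (mem_T_iff hp.2.1 (hcop p hp.2.1 hd)).mpr hp.2.2.2⟩
  have h2 : Y ⊆ X ∪ Nat.divisors q := by
    intro p hp
    simp only [hX, hY, Finset.mem_filter, Finset.mem_union] at hp ⊢
    by_cases hd : p ∈ Nat.divisors q
    · exact Or.inr hd
    · left
      have hc := hcop p hp.2.1 hd
      refine ⟨hp.1, hp.2.1, ?_, (mem_T_iff hp.2.1 hc).mp hp.2.2⟩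
      rw [← Nat.coprime_two_right]
      exact hc.coprime_dvd_right (two_dvd_modq _)
  have h3 := (Finset.card_le_card h1).trans (Finset.card_union_le _ _)
  have h4 := (Finset.card_le_card h2).trans (Finset.card_union_le _ _)
  have h5 : (X.card : ℝ) ≤ Y.card + q := by exact_mod_cast h3.trans (by omega)
  have h6 : (Y.card : ℝ) ≤ X.card + q := by exact_mod_cast h4.trans (by omega)
  rw [abs_le]
  constructor <;> linarith

/-- For every `n ≥ 1`, the set of (odd) primes `p` whose least quadratic
nonresidue equals the `n`-th prime `p_n` has relative density `2^{−n}` among all primes: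
`lim_{x→∞} #{odd primes p ≤ x : n_p = p_n}/π(x) = 1/2^n`. -/
theorem least_nonresidue_geometric_density (n : ℕ) (hn : 1 ≤ n) :
    Filter.Tendsto (fun x : ℕ =>
      ({p : ℕ | p.Prime ∧ Odd p ∧ p ≤ x ∧
          leastQuadraticNonresidue p = Nat.nth Nat.Prime (n - 1)}.ncard : ℝ)
        / (Nat.primeCounting x : ℝ))
      Filter.atTop (nhds (1 / 2 ^ n)) := by
  obtain ⟨N, rfl⟩ : ∃ N, n = N + 1 := ⟨n - 1, by omega⟩
  rw [Nat.add_sub_cancel]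
  have h1 := prime_density (Tset N) (by
    intro a ha
    unfold Tset at ha
    rw [Finset.mem_map] at ha
    obtain ⟨u, _, rfl⟩ := ha
    exact u.isUnit)
  rw [card_T] at h1
  have hpi : Tendsto (fun x : ℕ => (Nat.primeCounting x : ℝ)) atTop atTop :=
    tendsto_natCast_atTop_atTop.comp Nat.tendsto_primeCounting
  have h2 : Tendsto (fun x : ℕ =>
      ({p : ℕ | p.Prime ∧ Odd p ∧ p ≤ x ∧ leastQuadraticNonresidue p = rpr N}.ncard : ℝ)
        / (Nat.primeCounting x : ℝ) -
      (primeCnt (fun n => (n : ZMod (modq (N + 1))) ∈ Tset N) x : ℝ) / Nat.primeCounting x)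
      atTop (𝓝 0) := by
    rw [tendsto_zero_iff_abs_tendsto_zero]
    refine squeeze_zero (fun x => abs_nonneg _) ?_ (hpi.const_div_atTop (modq (N + 1) : ℝ))
    intro x
    simp only [Function.comp]
    rw [← sub_div, abs_div, abs_of_nonneg (Nat.cast_nonneg (Nat.primeCounting x) : (0 : ℝ) ≤ _)]
    exact div_le_div_of_nonneg_right (count_close N x) (Nat.cast_nonneg _)
  have h3 := h2.add h1
  rw [zero_add] at h3
  refine h3.congr fun x => ?_
  rw [sub_add_cancel]
  rfl
end
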